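/- Let $(M,g)$ be a smooth $4$-manifold with a Lorentzian metric of signature $(+,-,-,-)$ and Levi-Civita connection $\nabla$, with curvature conventions $(\nabla_a\nabla_b-\nabla_b\nabla_a)V^d=R_{abc}{}^dV^c$, $R_{ab}=R_{acb}{}^c$, $\Lambda=R/24$. Let $(o^A,\iota^A)$, $o_A\iota^A=1$, be a smooth spin dyad with null tetrad $l^a=o^A\bar o^{A'}$, $n^a=\iota^A\bar\iota^{A'}$, $m^a=o^A\bar\iota^{A'}$, $\bar m^a=\iota^A\bar o^{A'}$, and let $\kappa,\sigma,\rho,\tau,\epsilon,\beta$, $\rho',\tau',\epsilon',\beta'$ be the GHP spin coefficients ($\kappa=m^al^b\nabla_bl_a$, $\sigma=m^am^b\nabla_bl_a$, $\rho=m^a\bar m^b\nabla_bl_a$, $\tau=m^an^b\nabla_bl_a$, $\epsilon=\frac12(n^al^b\nabla_bl_a-\bar m^al^b\nabla_bm_a)$, $\beta=\frac12(n^am^b\nabla_bl_a-\bar m^am^b\nabla_bm_a)$; primes denote the exchange $l\leftrightarrow n$, $m\leftrightarrow\bar m$). Assume that $(M,g)$ is Einstein (the trace-free Ricci spinor vanishes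 and $\Lambda$ is constant) and of Petrov type II with repeated principal spinor $o^A$, i.e. everywhere $\Psi_0=\Psi_1=0$, $\Psi_2\neq0$ and $\kappa=\sigma=0$. The GHP derivative of a spinor field $\varphi$ of GHP weight $\{p,0\}$, $p\in\mathbb Z$, is $\Theta_{AA'}\varphi=\nabla_{AA'}\varphi+p\,\omega_{AA'}\varphi$ with $\omega_a=-\epsilon n_a+\epsilon' l_a-\beta' m_a+\beta\bar m_a$. Put $\tilde\Theta_{A'}=o^A\Theta_{AA'}$ and $\Theta_{A'}=\iota^A\Theta_{AA'}$ (which change the weight $\{p,0\}$ to $\{p+1,0\}$ and $\{p-1,0\}$), $\Box^\Theta_{A'B'}=\Theta_{A(A'}\Theta^A{}_{B')}$, $f_a=\rho n_a+\rho' l_a-\tau' m_a-\tau\bar m_a$, $\tilde f_{A'}=o^Af_{AA'}$, $f_{A'}=\iota^Af_{AA'}$ and $\sigma'_{A'}=\iota^A\iota^B\nabla_{AA'}\iota_B$, of weights $\{1,0\}$, $\{-1,0\}$ and $\{-3,0\}$. Indices are moved by $\xi^A=\epsilon^{AB}\xi_B$, $\xi_B=\xi^A\epsilon_{AB}$, and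 likewise for primed indices. Then on smooth spinor fields of GHP weight $\{p,0\}$ with any number of (upper or lower) primed indices and no unprimed ones: (i) $[\tilde\Theta_{A'},\tilde\Theta_{B'}]=0$; (ii) $[\tilde\Theta_{A'},\Theta_{B'}]=\bar\epsilon_{A'B'}\frac p2\bigl(2\tilde\Theta_{C'}f^{C'}-\tilde f_{C'}f^{C'}+6\Lambda\bigr)+\Box^\Theta_{A'B'}-f_{A'}\tilde\Theta_{B'}+\tilde f_{B'}\Theta_{A'}$; (iii) $[\Theta_{A'},\Theta_{B'}]=\bar\epsilon_{A'B'}\Bigl(\frac p2\bigl(\Theta_{C'}f^{C'}-\tilde\Theta_{C'}\sigma'^{C'}+\tilde f_{C'}\sigma'^{C'}\bigr)-\sigma'^{C'}\tilde\Theta_{C'}\Bigr)$. In particular $\tilde\Theta^{A'}\tilde\Theta_{A'}\varphi=0$ for every such field $\varphi$. -/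

import Mathlib

open scoped Manifold ContDiff Bundle

noncomputable section

namespace GHP

variable {M : Type*} [TopologicalSpace M] [ChartedSpace (EuclideanSpace ℝ (Fin 4)) M]

/-! ### Lorentzian metrics and their Levi-Civita connection -/

/-- The Minkowski matrix `diag(1,-1,-1,-1)`. -/
def minkowski (i j : Fin 4) : ℝ := if i = j then (if i = 0 then 1 else -1) else 0

/-- A smooth Lorentzian metric of signature `(+,-,-,-)` on a 4-manifold. -/
structure LorentzMetric (M : Type*) [TopologicalSpace M]
    [ChartedSpace (EuclideanSpace ℝ (Fin 4)) M] [IsManifold (𝓡 4) ∞ M] where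
  /-- the bilinear form `g_x` on `T_x M` -/
  val : ∀ x : M, TangentSpace (𝓡 4) x →L[ℝ] TangentSpace (𝓡 4) x →L[ℝ] ℝ
  symm : ∀ (x : M) (v w : TangentSpace (𝓡 4) x), val x v w = val x w v
  signature : ∀ x : M, ∃ b : Module.Basis (Fin 4) ℝ (TangentSpace (𝓡 4) x),
    ∀ i j, val x (b i) (b j) = minkowski i j
  contMDiff : ContMDiff (𝓡 4) ((𝓡 4).prod 𝓘(ℝ,
      EuclideanSpace ℝ (Fin 4) →L[ℝ] EuclideanSpace ℝ (Fin 4) →L[ℝ] ℝ)) ∞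
    (fun x ↦ Bundle.TotalSpace.mk'
      (EuclideanSpace ℝ (Fin 4) →L[ℝ] EuclideanSpace ℝ (Fin 4) →L[ℝ] ℝ)
      (E := fun x : M ↦ TangentSpace (𝓡 4) x →L[ℝ] TangentSpace (𝓡 4) x →L[ℝ] ℝ) x (val x))

/-- Affine connections on `M`. In Mathlib's convention `nab Y x v` is `(∇_v Y)(x)`. -/
abbrev AffineConnection (M : Type*) [TopologicalSpace M]
    [ChartedSpace (EuclideanSpace ℝ (Fin 4)) M] [IsManifold (𝓡 4) ∞ M] :=
  CovariantDerivative (𝓡 4) (EuclideanSpace ℝ (Fin 4)) (TangentSpace (𝓡 4) : M → Type _)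

/-- `nab` is the Levi-Civita connection of `g`: it is torsion-free,
`∇_X Y - ∇_Y X = [X, Y]`, and metric, `v (g(X, Y)) = g(∇_v X, Y) + g(X, ∇_v Y)`. -/
structure IsLeviCivita [IsManifold (𝓡 4) ∞ M] (g : LorentzMetric M)
    (nab : AffineConnection M) : Prop where
  torsion_free : ∀ (X Y : ∀ x : M, TangentSpace (𝓡 4) x) (x : M),
    MDifferentiableAt (𝓡 4) (𝓡 4).tangent (fun y ↦ (⟨y, X y⟩ : TangentBundle (𝓡 4) M)) x →
    MDifferentiableAt (𝓡 4) (𝓡 4).tangent (fun y ↦ (⟨y, Y y⟩ : TangentBundle (𝓡 4) M)) x →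
    nab Y x (X x) - nab X x (Y x) = VectorField.mlieBracket (𝓡 4) X Y x
  metric : ∀ (X Y : ∀ x : M, TangentSpace (𝓡 4) x) (x : M) (v : TangentSpace (𝓡 4) x),
    MDifferentiableAt (𝓡 4) (𝓡 4).tangent (fun y ↦ (⟨y, X y⟩ : TangentBundle (𝓡 4) M)) x →
    MDifferentiableAt (𝓡 4) (𝓡 4).tangent (fun y ↦ (⟨y, Y y⟩ : TangentBundle (𝓡 4) M)) x →
    mvfderiv (𝓡 4) (fun y ↦ g.val y (X y) (Y y)) x v
      = g.val x (nab X x v) (Y x) + g.val x (X x) (nab Y x v)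

/-! ### Complex vector fields -/

/-- A complex vector field `re + i im`, i.e. a section of `TM ⊗ ℂ`. -/
structure CVectorField (M : Type*) [TopologicalSpace M]
    [ChartedSpace (EuclideanSpace ℝ (Fin 4)) M] where
  re : ∀ x : M, TangentSpace (𝓡 4) x
  im : ∀ x : M, TangentSpace (𝓡 4) x

/-- Complex conjugate of a complex vector field. -/
def CVectorField.conj (V : CVectorField M) : CVectorField M := ⟨V.re, fun x ↦ -V.im x⟩

/-- Directional derivative `V(f)` of a complex function along a complex vector field. -/
def CVectorField.deriv (V : CVectorField M) (f : M → ℂ) (x : M) : ℂ :=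
  mvfderiv (𝓡 4) f x (V.re x) + Complex.I * mvfderiv (𝓡 4) f x (V.im x)

/-- Lie bracket, extended complex-bilinearly. -/
def CVectorField.bracket (V W : CVectorField M) : CVectorField M :=
  ⟨fun x ↦ VectorField.mlieBracket (𝓡 4) V.re W.re x - VectorField.mlieBracket (𝓡 4) V.im W.im x,
   fun x ↦ VectorField.mlieBracket (𝓡 4) V.re W.im x + VectorField.mlieBracket (𝓡 4) V.im W.re x⟩

variable [IsManifold (𝓡 4) ∞ M]

/-- The metric, extended complex-bilinearly. -/
def LorentzMetric.cval (g : LorentzMetric M) (V W : CVectorField M) (x : M) : ℂ :=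
  ((g.val x (V.re x) (W.re x) - g.val x (V.im x) (W.im x) : ℝ) : ℂ)
    + Complex.I * ((g.val x (V.re x) (W.im x) + g.val x (V.im x) (W.re x) : ℝ) : ℂ)

/-- `∇_V W`, extended complex-bilinearly. -/
def ccov (nab : AffineConnection M) (V W : CVectorField M) : CVectorField M :=
  ⟨fun x ↦ nab W.re x (V.re x) - nab W.im x (V.im x),
   fun x ↦ nab W.im x (V.re x) + nab W.re x (V.im x)⟩

/-- The Riemann tensor `R_{abcd} V^a W^b Z^c U^d = g(∇_V ∇_W Z - ∇_W ∇_V Z - ∇_{[V,W]} Z, U)`,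
that is, `(∇_a ∇_b - ∇_b ∇_a) Z^d = R_{abc}{}^d Z^c`. -/
def riemann (g : LorentzMetric M) (nab : AffineConnection M) (V W Z U : CVectorField M)
    (x : M) : ℂ :=
  g.cval (ccov nab V (ccov nab W Z)) U x - g.cval (ccov nab W (ccov nab V Z)) U x
    - g.cval (ccov nab (V.bracket W) Z) U x

/-! ### Spin dyads

A spin dyad `(o^A, ι^A)`, `o_A ι^A = 1`, is a global frame of the spinor bundle `S`. Under
`TM ⊗ ℂ ≅ S ⊗ S'` it corresponds to the null tetrad
`l = o ō`, `n = ι ῑ`, `m = o ῑ`, `m̄ = ι ō`. All spinors below are given by their components in the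
dyad, `0` standing for `o` and `1` for `ι`. -/

/-- The smooth null tetrad `(l, n, m, m̄)` of a spin dyad, `l` and `n` real and `m = mre + i mim`,
normalised by `l·n = 1`, `m·m̄ = -1`, all other products being zero. -/
structure SpinDyad (g : LorentzMetric M) where
  lre : ∀ x : M, TangentSpace (𝓡 4) x
  nre : ∀ x : M, TangentSpace (𝓡 4) x
  mre : ∀ x : M, TangentSpace (𝓡 4) x
  mim : ∀ x : M, TangentSpace (𝓡 4) x
  smooth_l : ContMDiff (𝓡 4) (𝓡 4).tangent ∞ (fun x ↦ (⟨x, lre x⟩ : TangentBundle (𝓡 4) M))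
  smooth_n : ContMDiff (𝓡 4) (𝓡 4).tangent ∞ (fun x ↦ (⟨x, nre x⟩ : TangentBundle (𝓡 4) M))
  smooth_mre : ContMDiff (𝓡 4) (𝓡 4).tangent ∞ (fun x ↦ (⟨x, mre x⟩ : TangentBundle (𝓡 4) M))
  smooth_mim : ContMDiff (𝓡 4) (𝓡 4).tangent ∞ (fun x ↦ (⟨x, mim x⟩ : TangentBundle (𝓡 4) M))
  ll : ∀ x, g.val x (lre x) (lre x) = 0
  nn : ∀ x, g.val x (nre x) (nre x) = 0
  ln : ∀ x, g.val x (lre x) (nre x) = 1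
  lm : ∀ x, g.cval ⟨lre, 0⟩ ⟨mre, mim⟩ x = 0
  nm : ∀ x, g.cval ⟨nre, 0⟩ ⟨mre, mim⟩ x = 0
  mm : ∀ x, g.cval ⟨mre, mim⟩ ⟨mre, mim⟩ x = 0
  mmbar : ∀ x, g.cval ⟨mre, mim⟩ (CVectorField.conj ⟨mre, mim⟩) x = -1

namespace SpinDyad

variable {g : LorentzMetric M} (d : SpinDyad g) (nab : AffineConnection M)

def l : CVectorField M := ⟨d.lre, 0⟩
def n : CVectorField M := ⟨d.nre, 0⟩
def m : CVectorField M := ⟨d.mre, d.mim⟩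
def mbar : CVectorField M := d.m.conj

/-- The tetrad vector `e_{AA'}` belonging to the `A`-th dyad spinor and the conjugate of the
`A'`-th: `e_{00'} = l`, `e_{01'} = m`, `e_{10'} = m̄`, `e_{11'} = n`. -/
def tet (A A' : Fin 2) : CVectorField M := ![![d.l, d.m], ![d.mbar, d.n]] A A'

/-! #### Curvature of an Einstein, type II background -/

/-- Ricci tensor `R_{bd} = g^{ac} R_{abcd}`, with
`g^{ac} = l^a n^c + n^a l^c - m^a m̄^c - m̄^a m^c`. -/
def ricci (W U : CVectorField M) (x : M) : ℂ :=
  riemann g nab d.l W d.n U x + riemann g nab d.n W d.l U x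
    - riemann g nab d.m W d.mbar U x - riemann g nab d.mbar W d.m U x

/-- Scalar curvature `R = g^{bd} R_{bd}`. -/
def scalarCurv (x : M) : ℂ :=
  d.ricci nab d.l d.n x + d.ricci nab d.n d.l x
    - d.ricci nab d.m d.mbar x - d.ricci nab d.mbar d.m x

/-- Weyl tensor `C_{abcd}`. -/
def weyl (V W Z U : CVectorField M) (x : M) : ℂ :=
  riemann g nab V W Z U x
    - (1 / 2) * (g.cval V Z x * d.ricci nab W U x - g.cval V U x * d.ricci nab W Z x
        + g.cval W U x * d.ricci nab V Z x - g.cval W Z x * d.ricci nab V U x)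
    + (d.scalarCurv nab x / 6) * (g.cval V Z x * g.cval W U x - g.cval V U x * g.cval W Z x)

/-- Trace-free Ricci spinor `Φ_{ABA'B'} = -(R_{ab} - R g_{ab} / 4) / 2`. -/
def Phi (A B A' B' : Fin 2) (x : M) : ℂ :=
  -(1 / 2) * (d.ricci nab (d.tet A A') (d.tet B B') x
    - (d.scalarCurv nab x / 4) * g.cval (d.tet A A') (d.tet B B') x)

/-- `Ψ₀ = C_{abcd} l^a m^b l^c m^d`. -/
def Psi0 (x : M) : ℂ := d.weyl nab d.l d.m d.l d.m x
/-- `Ψ₁ = C_{abcd} l^a m^b l^c n^d`. -/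
def Psi1 (x : M) : ℂ := d.weyl nab d.l d.m d.l d.n x
/-- `Ψ₂ = C_{abcd} l^a m^b m̄^c n^d`. -/
def Psi2 (x : M) : ℂ := d.weyl nab d.l d.m d.mbar d.n x

/-! #### Spin coefficients (primes denote the exchange `l ↔ n`, `m ↔ m̄`) -/

def kappa (x : M) : ℂ := g.cval d.m (ccov nab d.l d.l) x
def sigma (x : M) : ℂ := g.cval d.m (ccov nab d.m d.l) x
def rho (x : M) : ℂ := g.cval d.m (ccov nab d.mbar d.l) x
def tau (x : M) : ℂ := g.cval d.m (ccov nab d.n d.l) x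
def rho' (x : M) : ℂ := g.cval d.mbar (ccov nab d.m d.n) x
def tau' (x : M) : ℂ := g.cval d.mbar (ccov nab d.l d.n) x
def epsilon (x : M) : ℂ :=
  (g.cval d.n (ccov nab d.l d.l) x - g.cval d.mbar (ccov nab d.l d.m) x) / 2
def beta (x : M) : ℂ :=
  (g.cval d.n (ccov nab d.m d.l) x - g.cval d.mbar (ccov nab d.m d.m) x) / 2
def epsilon' (x : M) : ℂ :=
  (g.cval d.l (ccov nab d.n d.n) x - g.cval d.m (ccov nab d.n d.mbar) x) / 2
def beta' (x : M) : ℂ :=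
  (g.cval d.l (ccov nab d.mbar d.n) x - g.cval d.m (ccov nab d.mbar d.mbar) x) / 2

/-- The Einstein condition: vanishing trace-free Ricci spinor and constant `R / 24 = Λ`. -/
def IsEinstein (Λ : ℝ) : Prop :=
  (∀ A B A' B' x, d.Phi nab A B A' B' x = 0) ∧ ∀ x, d.scalarCurv nab x / 24 = (Λ : ℂ)

/-- Petrov type II with repeated principal spinor `o^A` (the first dyad spinor). -/
def IsTypeII : Prop :=
  ∀ x, d.Psi0 nab x = 0 ∧ d.Psi1 nab x = 0 ∧ d.Psi2 nab x ≠ 0 ∧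
    d.kappa nab x = 0 ∧ d.sigma nab x = 0

/-- The 1-form `f_a = ρ n_a + ρ' l_a - τ' m_a - τ m̄_a`. -/
def f (V : CVectorField M) (x : M) : ℂ :=
  d.rho nab x * g.cval d.n V x + d.rho' nab x * g.cval d.l V x
    - d.tau' nab x * g.cval d.m V x - d.tau nab x * g.cval d.mbar V x

/-- The GHP connection 1-form `ω_a = -ε n_a + ε' l_a - β' m_a + β m̄_a`. -/
def omega (V : CVectorField M) (x : M) : ℂ :=
  -(d.epsilon nab x) * g.cval d.n V x + d.epsilon' nab x * g.cval d.l V x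
    - d.beta' nab x * g.cval d.m V x + d.beta nab x * g.cval d.mbar V x

end SpinDyad

/-! ### Spinor fields -/

/-- The components of `ε_{AB}`, `ε^{AB}`, `ε̄_{A'B'}`, `ε̄^{A'B'}` in a normalised dyad; indices are
moved by `ξ^A = ε^{AB} ξ_B`, `ξ_B = ξ^A ε_{AB}`. -/
def eps (A B : Fin 2) : ℂ := !![0, 1; -1, 0] A B

/-- Components of `o^A`. -/
def oUp : Fin 2 → ℂ := ![1, 0]

/-- Components of `ι^A`. -/
def iotaUp : Fin 2 → ℂ := ![0, 1]

/-- The type of a spinor index: primed or unprimed, upper or lower. -/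
structure IndexType where
  primed : Bool
  upper : Bool

/-- A lower unprimed index. -/
def low : IndexType := ⟨false, false⟩

/-- A lower primed index. -/
def lowP : IndexType := ⟨true, false⟩

/-- Spinor fields with `r` indices, given by their components in the dyad. -/
abbrev SpinorField (M : Type*) (r : ℕ) := M → (Fin r → Fin 2) → ℂ

/-- Smoothness of a spinor field. -/
def SpinorField.Smooth {r : ℕ} (φ : SpinorField M r) : Prop :=
  ∀ I, ContMDiff (𝓡 4) 𝓘(ℝ, ℂ) ∞ (fun x ↦ φ x I)

namespace SpinDyad

variable {g : LorentzMetric M} (d : SpinDyad g) (nab : AffineConnection M)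

/-- The spin connection coefficients `γ_{AA'B}{}^C`, defined by `∇_{AA'} ζ_B = γ_{AA'B}{}^C ζ_C` for
the dyad `ζ_0 = o`, `ζ_1 = ι`. The spin connection is the one which is compatible with `ε_{AB}` and
induces the Levi-Civita connection on `TM ⊗ ℂ ≅ S ⊗ S'`, that is,
`∇ e_{BB'} = γ_B{}^C e_{CB'} + γ̄_{B'}{}^{C'} e_{BC'}` with `γ`, `γ̄` trace-free; taking the trace over
the primed indices, `γ_{aB}{}^C = ½ (∇_a e_{BB'})^{CB'}`. -/
def spinConn (A A' B C : Fin 2) (x : M) : ℂ :=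
  (1 / 2) * ∑ B' : Fin 2, ∑ D : Fin 2, ∑ D' : Fin 2,
    eps C D * eps B' D' * g.cval (ccov nab (d.tet A A') (d.tet B B')) (d.tet D D') x

/-- The coefficients of the conjugate connection on `S'`: `∇_{AA'} ζ̄_{B'} = γ̄_{AA'B'}{}^{C'} ζ̄_{C'}`. -/
def spinConnP (A A' B' C' : Fin 2) (x : M) : ℂ :=
  (starRingEnd ℂ) (d.spinConn nab A' A B' C' x)

/-- The matrix by which the spin connection acts on an index of the given type. -/
def indexConn (s : IndexType) (A A' : Fin 2) (x : M) (b c : Fin 2) : ℂ :=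
  match s.primed, s.upper with
  | false, true => d.spinConn nab A A' c b x
  | false, false => -d.spinConn nab A A' b c x
  | true, true => d.spinConnP nab A A' c b x
  | true, false => -d.spinConnP nab A A' b c x

/-- `∇_{AA'} φ` for a spinor field with indices of types `k`. -/
def covSpinor {r : ℕ} (k : Fin r → IndexType) (φ : SpinorField M r) (A A' : Fin 2) (x : M)
    (I : Fin r → Fin 2) : ℂ :=
  (d.tet A A').deriv (fun y ↦ φ y I) x
    + ∑ j : Fin r, ∑ c : Fin 2, d.indexConn nab (k j) A A' x (I j) c * φ x (Function.update I j c)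

/-- The GHP derivative `Θ_{AA'} φ = ∇_{AA'} φ + p ω_{AA'} φ` of a spinor field of GHP weight `{p,0}`;
its first two indices are `A`, `A'`. -/
def Theta (p : ℤ) {r : ℕ} (k : Fin r → IndexType) (φ : SpinorField M r) : SpinorField M (r + 2) :=
  fun x I ↦
    let A := I 0
    let A' := I 1
    let J : Fin r → Fin 2 := fun j ↦ I j.succ.succ
    d.covSpinor nab k φ A A' x J + (p : ℂ) * d.omega nab (d.tet A A') x * φ x J

/-- `Θ̃_{A'} = o^A Θ_{AA'}` on weight `{p,0}`; the new index `A'` comes first, and the result has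
weight `{p+1,0}`. -/
def ThetaTilde (p : ℤ) {r : ℕ} (k : Fin r → IndexType) (φ : SpinorField M r) :
    SpinorField M (r + 1) :=
  fun x I ↦ ∑ A : Fin 2, oUp A * d.Theta nab p k φ x (Fin.cons A I)

/-- `Θ_{A'} = ι^A Θ_{AA'}` on weight `{p,0}`; the new index `A'` comes first, and the result has
weight `{p-1,0}`. -/
def ThetaIota (p : ℤ) {r : ℕ} (k : Fin r → IndexType) (φ : SpinorField M r) :
    SpinorField M (r + 1) :=
  fun x I ↦ ∑ A : Fin 2, iotaUp A * d.Theta nab p k φ x (Fin.cons A I)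

/-- `Θ_{AA'} Θ_{BB'} φ`. -/
def Theta2 (p : ℤ) {r : ℕ} (k : Fin r → IndexType) (φ : SpinorField M r) (x : M)
    (A A' B B' : Fin 2) (I : Fin r → Fin 2) : ℂ :=
  d.Theta nab p (Fin.cons low (Fin.cons lowP k)) (d.Theta nab p k φ) x
    (Fin.cons A (Fin.cons A' (Fin.cons B (Fin.cons B' I))))

/-- The primed GHP curvature operator `□^Θ_{A'B'} φ = Θ_{A(A'} Θ^A{}_{B')} φ`. -/
def boxTheta (p : ℤ) {r : ℕ} (k : Fin r → IndexType) (φ : SpinorField M r) (x : M)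
    (A' B' : Fin 2) (I : Fin r → Fin 2) : ℂ :=
  (1 / 2) * ∑ A : Fin 2, ∑ B : Fin 2,
    eps A B * (d.Theta2 nab p k φ x A A' B B' I + d.Theta2 nab p k φ x A B' B A' I)

/-- `f̃_{A'} = o^A f_{AA'}`, of GHP weight `{1,0}`. -/
def fTilde : SpinorField M 1 := fun x I ↦ ∑ A : Fin 2, oUp A * d.f nab (d.tet A (I 0)) x

/-- `f_{A'} = ι^A f_{AA'}`, of GHP weight `{-1,0}`. -/
def fIota : SpinorField M 1 := fun x I ↦ ∑ A : Fin 2, iotaUp A * d.f nab (d.tet A (I 0)) x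

/-- `ι_B = ι^A ε_{AB}`. -/
def iotaLow : SpinorField M 1 := fun _ I ↦ ∑ A : Fin 2, iotaUp A * eps A (I 0)

/-- `σ'_{A'} = ι^A ι^B ∇_{AA'} ι_B`, of GHP weight `{-3,0}`. -/
def sigmaP : SpinorField M 1 := fun x I ↦
  ∑ A : Fin 2, ∑ B : Fin 2,
    iotaUp A * iotaUp B * d.covSpinor nab ![low] iotaLow A (I 0) x ![B]

end SpinDyad

/-- The contraction `α_{C'} β^{C'} = α_{C'} ε̄^{C'D'} β_{D'}`. -/
def contract (T : Fin 2 → Fin 2 → ℂ) : ℂ := ∑ C : Fin 2, ∑ D : Fin 2, eps C D * T C D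

end GHP

end

open GHP

noncomputable section

namespace GHP

section

variable {M : Type*} [TopologicalSpace M] [ChartedSpace (EuclideanSpace ℝ (Fin 4)) M]

variable [IsManifold (𝓡 4) ∞ M]

/-! ### Smooth real vector fields -/

/-- Smoothness of a real vector field. -/
def SmoothVF (X : ∀ x : M, TangentSpace (𝓡 4) x) : Prop :=
  ContMDiff (𝓡 4) (𝓡 4).tangent ∞ (fun x ↦ (⟨x, X x⟩ : TangentBundle (𝓡 4) M))

namespace SmoothVF

variable {X Y Z : ∀ x : M, TangentSpace (𝓡 4) x}

theorem mdiffAt (hX : SmoothVF X) (x : M) :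
    MDifferentiableAt (𝓡 4) (𝓡 4).tangent (fun y ↦ (⟨y, X y⟩ : TangentBundle (𝓡 4) M)) x :=
  (hX x).mdifferentiableAt (by simp)

theorem add (hX : SmoothVF X) (hY : SmoothVF Y) : SmoothVF (X + Y) :=
  ContMDiff.add_section hX hY

theorem sub (hX : SmoothVF X) (hY : SmoothVF Y) : SmoothVF (X - Y) :=
  ContMDiff.sub_section hX hY

theorem neg (hX : SmoothVF X) : SmoothVF (-X) :=
  ContMDiff.neg_section hX

theorem smul {f : M → ℝ} (hf : ContMDiff (𝓡 4) 𝓘(ℝ) ∞ f) (hX : SmoothVF X) : SmoothVF (f • X) :=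
  ContMDiff.smul_section hf hX

theorem zero : SmoothVF (0 : ∀ x : M, TangentSpace (𝓡 4) x) :=
  Bundle.contMDiff_zeroSection ℝ (TangentSpace (𝓡 4) : M → Type _)

theorem bracket (hX : SmoothVF X) (hY : SmoothVF Y) :
    SmoothVF (VectorField.mlieBracket (𝓡 4) X Y) := by
  have : IsManifold (𝓡 4) (((⊤ : ℕ∞) : WithTop ℕ∞) + 1) M :=
    IsManifold.of_le (n := ∞) (by simp)
  have : IsManifold (𝓡 4) (minSmoothness ℝ 2) M :=
    IsManifold.of_le (n := ∞) (by simpa using ENat.LEInfty.out)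
  exact ContDiff.mlieBracket_vectorField (n := ⊤) (m := ⊤) hX hY (by simp)

/-- The derivative of a smooth function along a smooth vector field is smooth. -/
theorem deriv {F : Type*} [NormedAddCommGroup F] [NormedSpace ℝ F] {f : M → F}
    (hf : ContMDiff (𝓡 4) 𝓘(ℝ, F) ∞ f) (hX : SmoothVF X) :
    ContMDiff (𝓡 4) 𝓘(ℝ, F) ∞ (fun x ↦ mvfderiv (𝓡 4) f x (X x)) := by
  have h1 := (hf.contMDiff_tangentMap (m := ∞) (by simp)).comp hX
  exact (contMDiff_snd_tangentBundle_modelSpace F 𝓘(ℝ, F)).comp h1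

theorem metric (g : LorentzMetric M) (hX : SmoothVF X) (hY : SmoothVF Y) :
    ContMDiff (𝓡 4) 𝓘(ℝ) ∞ (fun x ↦ g.val x (X x) (Y x)) := by
  intro x
  have h : ContMDiffAt (𝓡 4) ((𝓡 4).prod 𝓘(ℝ)) ∞
      (fun m ↦ Bundle.TotalSpace.mk' ℝ (E := Bundle.Trivial M ℝ) m (g.val m (X m) (Y m))) x :=
    ContMDiffAt.clm_bundle_apply₂ (F₁ := EuclideanSpace ℝ (Fin 4))
      (F₂ := EuclideanSpace ℝ (Fin 4)) (g.contMDiff x) (hX x) (hY x)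
  rw [Bundle.contMDiffAt_section] at h
  exact h

end SmoothVF

theorem mlieBracket_jacobi {X Y Z : ∀ x : M, TangentSpace (𝓡 4) x} (hX : SmoothVF X)
    (hY : SmoothVF Y) (hZ : SmoothVF Z) (x : M) :
    VectorField.mlieBracket (𝓡 4) X (VectorField.mlieBracket (𝓡 4) Y Z) x =
      VectorField.mlieBracket (𝓡 4) (VectorField.mlieBracket (𝓡 4) X Y) Z x
      + VectorField.mlieBracket (𝓡 4) Y (VectorField.mlieBracket (𝓡 4) X Z) x := by
  have : IsManifold (𝓡 4) (minSmoothness ℝ 3) M :=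
    IsManifold.of_le (n := ∞) (by simpa using ENat.LEInfty.out)
  exact VectorField.leibniz_identity_mlieBracket_apply
    ((hX x).of_le (by simpa using ENat.LEInfty.out))
    ((hY x).of_le (by simpa using ENat.LEInfty.out))
    ((hZ x).of_le (by simpa using ENat.LEInfty.out))

/-- The Lie bracket acts on functions as the commutator, at points where some smooth vector field
does not vanish. -/
theorem mvfderiv_mlieBracket {X Y Z : ∀ x : M, TangentSpace (𝓡 4) x} (hX : SmoothVF X)
    (hY : SmoothVF Y) (hZ : SmoothVF Z) (x : M) (hZx : Z x ≠ 0) {f : M → ℝ}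
    (hf : ContMDiff (𝓡 4) 𝓘(ℝ) ∞ f) :
    mvfderiv (𝓡 4) f x (VectorField.mlieBracket (𝓡 4) X Y x) =
      mvfderiv (𝓡 4) (fun y ↦ mvfderiv (𝓡 4) f y (Y y)) x (X x)
        - mvfderiv (𝓡 4) (fun y ↦ mvfderiv (𝓡 4) f y (X y)) x (Y x) := by
  have hfd : ∀ {h : M → ℝ}, ContMDiff (𝓡 4) 𝓘(ℝ) ∞ h → ∀ y, MDifferentiableAt (𝓡 4) 𝓘(ℝ) h y :=
    fun hh y ↦ (hh y).mdifferentiableAt (by simp)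
  have br : ∀ {V W : ∀ x : M, TangentSpace (𝓡 4) x} {h : M → ℝ}, SmoothVF W →
      ContMDiff (𝓡 4) 𝓘(ℝ) ∞ h → VectorField.mlieBracket (𝓡 4) V (h • W) =
        (fun y ↦ mvfderiv (𝓡 4) h y (V y)) • W + h • VectorField.mlieBracket (𝓡 4) V W := by
    intro V W h hW hh
    ext1 y
    exact VectorField.mlieBracket_smul_right (hfd hh y) (hW.mdiffAt y)
  have add : ∀ {V W W' : ∀ x : M, TangentSpace (𝓡 4) x}, SmoothVF W → SmoothVF W' →
      VectorField.mlieBracket (𝓡 4) V (W + W') = VectorField.mlieBracket (𝓡 4) V W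
        + VectorField.mlieBracket (𝓡 4) V W' := by
    intro V W W' hW hW'
    ext1 y
    exact VectorField.mlieBracket_add_right (hW.mdiffAt y) (hW'.mdiffAt y)
  have hXf := SmoothVF.deriv hf hX
  have hYf := SmoothVF.deriv hf hY
  have key := mlieBracket_jacobi hX hY (hZ.smul hf) x
  have key0 := mlieBracket_jacobi hX hY hZ x
  rw [br hZ hf, br hZ hf, br hZ hf, add (hZ.smul hYf) ((hY.bracket hZ).smul hf),
    add (hZ.smul hXf) ((hX.bracket hZ).smul hf), br hZ hYf, br (hY.bracket hZ) hf, br hZ hXf,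
    br (hX.bracket hZ) hf] at key
  simp only [Pi.add_apply, Pi.smul_apply', key0] at key
  have h3 : (mvfderiv (𝓡 4) f x (VectorField.mlieBracket (𝓡 4) X Y x)
      - (mvfderiv (𝓡 4) (fun y ↦ mvfderiv (𝓡 4) f y (Y y)) x (X x)
        - mvfderiv (𝓡 4) (fun y ↦ mvfderiv (𝓡 4) f y (X y)) x (Y x))) • Z x = 0 := by
    linear_combination (norm := module) (-1 : ℝ) • key
  have := (smul_eq_zero.mp h3).resolve_right hZx
  linarith

end

section

variable {M : Type*} [TopologicalSpace M] [ChartedSpace (EuclideanSpace ℝ (Fin 4)) M]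
  [IsManifold (𝓡 4) ∞ M]

/-! ### The real tetrad and smoothness of the Levi-Civita connection -/

namespace SpinDyad

variable {g : LorentzMetric M} (d : SpinDyad g)

/-- The real orthogonality relations of a null tetrad. -/
theorem real_relations (x : M) :
    g.val x (d.lre x) (d.mre x) = 0 ∧ g.val x (d.lre x) (d.mim x) = 0 ∧
    g.val x (d.nre x) (d.mre x) = 0 ∧ g.val x (d.nre x) (d.mim x) = 0 ∧
    g.val x (d.mre x) (d.mim x) = 0 ∧ g.val x (d.mre x) (d.mre x) = -1 / 2 ∧
    g.val x (d.mim x) (d.mim x) = -1 / 2 := by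
  have h1 := d.lm x
  have h2 := d.nm x
  have h3 := d.mm x
  have h4 := d.mmbar x
  have hs := g.symm x (d.mim x) (d.mre x)
  simp only [LorentzMetric.cval, CVectorField.conj, Complex.ext_iff, Pi.zero_apply, map_zero,
    map_neg, zero_apply, hs] at h1 h2 h3 h4
  simp at h1 h2 h3 h4
  refine ⟨h1.1, h1.2, h2.1, h2.2, ?_, ?_, ?_⟩ <;> linarith [h3.1, h3.2]

/-- Expansion of a tangent vector in the real tetrad. -/
theorem expand (x : M) (v : TangentSpace (𝓡 4) x) :
    v = g.val x v (d.nre x) • d.lre x + g.val x v (d.lre x) • d.nre x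
      - (2 * g.val x v (d.mre x)) • d.mre x - (2 * g.val x v (d.mim x)) • d.mim x := by
  obtain ⟨h1, h2, h3, h4, h5, h6, h7⟩ := d.real_relations x
  have h1' := g.symm x (d.mre x) (d.lre x)
  have h2' := g.symm x (d.mim x) (d.lre x)
  have h3' := g.symm x (d.mre x) (d.nre x)
  have h4' := g.symm x (d.mim x) (d.nre x)
  have h5' := g.symm x (d.mim x) (d.mre x)
  have h8' := g.symm x (d.nre x) (d.lre x)
  rw [h1] at h1'; rw [h2] at h2'; rw [h3] at h3'; rw [h4] at h4'; rw [h5] at h5'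
  rw [d.ln] at h8'
  let b : Fin 4 → TangentSpace (𝓡 4) x := ![d.lre x, d.nre x, d.mre x, d.mim x]
  have hli : LinearIndependent ℝ b := by
    rw [Fintype.linearIndependent_iff]
    intro c hc
    simp only [b, Fin.sum_univ_four, Matrix.cons_val] at hc
    have e : ∀ w,
        g.val x (c 0 • d.lre x + c 1 • d.nre x + c 2 • d.mre x + c 3 • d.mim x) w = 0 := by
      intro w; rw [hc]; simp
    have e0 := e (d.nre x)
    have e1 := e (d.lre x)
    have e2 := e (d.mre x)
    have e3 := e (d.mim x)
    simp [d.ll, d.nn, d.ln, h1, h2, h3, h4, h5, h6, h7, h1', h2', h3', h4', h5', h8'] at e0 e1 e2 e3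
    intro i
    fin_cases i <;> simp <;> linarith
  have hcard : Fintype.card (Fin 4) = Module.finrank ℝ (TangentSpace (𝓡 4) x) := by
    change _ = Module.finrank ℝ (EuclideanSpace ℝ (Fin 4))
    simp
  have : FiniteDimensional ℝ (TangentSpace (𝓡 4) x) :=
    inferInstanceAs (FiniteDimensional ℝ (EuclideanSpace ℝ (Fin 4)))
  let B := basisOfLinearIndependentOfCardEqFinrank hli hcard
  have hv := B.sum_repr v
  simp only [B, coe_basisOfLinearIndependentOfCardEqFinrank, Fin.sum_univ_four, b,
    Matrix.cons_val] at hv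
  rw [← hv]
  simp only [map_add, map_smul, add_apply, smul_apply,
    smul_eq_mul, d.ll, d.nn, d.ln, h1, h2, h3, h4, h5, h6, h7, h1', h2', h3', h4', h5', h8']
  module

theorem lre_ne_zero (x : M) : d.lre x ≠ 0 := by
  intro h
  have := d.ln x
  simp [h] at this

theorem smooth_of_metric (d : SpinDyad g) {X : ∀ x : M, TangentSpace (𝓡 4) x}
    (h : ∀ Z : ∀ x : M, TangentSpace (𝓡 4) x, SmoothVF Z →
      ContMDiff (𝓡 4) 𝓘(ℝ) ∞ (fun x ↦ g.val x (X x) (Z x))) : SmoothVF X := by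
  have hm := ((SmoothVF.smul (h _ d.smooth_n) d.smooth_l).add
    (SmoothVF.smul (h _ d.smooth_l) d.smooth_n)).sub
    (SmoothVF.smul (contMDiff_const (c := (2 : ℝ)) |>.mul (h _ d.smooth_mre)) d.smooth_mre) |>.sub
    (SmoothVF.smul (contMDiff_const (c := (2 : ℝ)) |>.mul (h _ d.smooth_mim)) d.smooth_mim)
  convert! hm using 1
  ext1 x
  exact d.expand x (X x)

end SpinDyad

section LeviCivita

variable {g : LorentzMetric M} {nab : AffineConnection M}

/-- The real covariant derivative `∇_X Y`. -/
def cov (nab : AffineConnection M) (X Y : ∀ x : M, TangentSpace (𝓡 4) x) :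
    ∀ x : M, TangentSpace (𝓡 4) x := fun x ↦ nab Y x (X x)

theorem nab_add {X Y : ∀ x : M, TangentSpace (𝓡 4) x} (hX : SmoothVF X) (hY : SmoothVF Y) (x : M)
    (v : TangentSpace (𝓡 4) x) : nab (X + Y) x v = nab X x v + nab Y x v := by
  rw [nab.isCovariantDerivativeOnUniv.add (hX.mdiffAt x) (hY.mdiffAt x)]
  rfl

theorem nab_sub {X Y : ∀ x : M, TangentSpace (𝓡 4) x} (hX : SmoothVF X) (hY : SmoothVF Y) (x : M)
    (v : TangentSpace (𝓡 4) x) : nab (X - Y) x v = nab X x v - nab Y x v := by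
  have := nab_add (nab := nab) (hX.sub hY) hY x v
  rw [sub_add_cancel] at this
  rw [this, add_sub_cancel_right]

/-- The Koszul formula. -/
theorem IsLeviCivita.koszul (hLC : IsLeviCivita g nab) {X Y Z : ∀ x : M, TangentSpace (𝓡 4) x}
    (hX : SmoothVF X) (hY : SmoothVF Y) (hZ : SmoothVF Z) (x : M) :
    g.val x (cov nab X Y x) (Z x) = (1 / 2) *
      (mvfderiv (𝓡 4) (fun y ↦ g.val y (Y y) (Z y)) x (X x)
        + mvfderiv (𝓡 4) (fun y ↦ g.val y (X y) (Z y)) x (Y x)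
        - mvfderiv (𝓡 4) (fun y ↦ g.val y (X y) (Y y)) x (Z x)
        + g.val x (VectorField.mlieBracket (𝓡 4) X Y x) (Z x)
        - g.val x (VectorField.mlieBracket (𝓡 4) X Z x) (Y x)
        - g.val x (VectorField.mlieBracket (𝓡 4) Y Z x) (X x)) := by
  rw [hLC.metric _ _ x _ (hY.mdiffAt x) (hZ.mdiffAt x),
    hLC.metric _ _ x _ (hX.mdiffAt x) (hZ.mdiffAt x),
    hLC.metric _ _ x _ (hX.mdiffAt x) (hY.mdiffAt x),
    ← hLC.torsion_free _ _ x (hX.mdiffAt x) (hY.mdiffAt x),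
    ← hLC.torsion_free _ _ x (hX.mdiffAt x) (hZ.mdiffAt x),
    ← hLC.torsion_free _ _ x (hY.mdiffAt x) (hZ.mdiffAt x)]
  simp only [map_sub, sub_apply, cov]
  rw [g.symm x (Y x) (nab Z x (X x)), g.symm x (X x) (nab Z x (Y x)),
    g.symm x (X x) (nab Y x (Z x))]
  ring

theorem IsLeviCivita.smooth_cov (hLC : IsLeviCivita g nab) (d : SpinDyad g)
    {X Y : ∀ x : M, TangentSpace (𝓡 4) x} (hX : SmoothVF X) (hY : SmoothVF Y) :
    SmoothVF (cov nab X Y) := by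
  refine d.smooth_of_metric fun Z hZ ↦ ?_
  rw [funext (hLC.koszul hX hY hZ)]
  exact contMDiff_const.mul
    ((((((SmoothVF.deriv (hY.metric g hZ) hX).add (SmoothVF.deriv (hX.metric g hZ) hY)).sub
      (SmoothVF.deriv (hX.metric g hY) hZ)).add ((hX.bracket hY).metric g hZ)).sub
      ((hX.bracket hZ).metric g hY)).sub ((hY.bracket hZ).metric g hX))

theorem IsLeviCivita.cov_sub_cov (hLC : IsLeviCivita g nab)
    {X Y : ∀ x : M, TangentSpace (𝓡 4) x} (hX : SmoothVF X) (hY : SmoothVF Y) :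
    cov nab X Y - cov nab Y X = VectorField.mlieBracket (𝓡 4) X Y := by
  ext1 x
  exact hLC.torsion_free _ _ x (hX.mdiffAt x) (hY.mdiffAt x)

/-- The curvature operator `R(X, Y) Z`. -/
def curv (nab : AffineConnection M) (X Y Z : ∀ x : M, TangentSpace (𝓡 4) x) :
    ∀ x : M, TangentSpace (𝓡 4) x :=
  cov nab X (cov nab Y Z) - cov nab Y (cov nab X Z)
    - cov nab (VectorField.mlieBracket (𝓡 4) X Y) Z

/-- The first Bianchi identity. -/
theorem IsLeviCivita.bianchi (hLC : IsLeviCivita g nab) (d : SpinDyad g)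
    {X Y Z : ∀ x : M, TangentSpace (𝓡 4) x} (hX : SmoothVF X) (hY : SmoothVF Y)
    (hZ : SmoothVF Z) : curv nab X Y Z + curv nab Y Z X + curv nab Z X Y = 0 := by
  have key : ∀ {U V W : ∀ x : M, TangentSpace (𝓡 4) x}, SmoothVF U → SmoothVF V → SmoothVF W →
      cov nab U (cov nab V W) - cov nab U (cov nab W V)
        - cov nab (VectorField.mlieBracket (𝓡 4) V W) U
      = VectorField.mlieBracket (𝓡 4) U (VectorField.mlieBracket (𝓡 4) V W) := by
    intro U V W hU hV hW
    rw [← hLC.cov_sub_cov hU (hV.bracket hW), ← hLC.cov_sub_cov hV hW]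
    congr 1
    ext1 x
    exact (nab_sub (hLC.smooth_cov d hV hW) (hLC.smooth_cov d hW hV) x (U x)).symm
  have h1 := key hX hY hZ
  have h2 := key hY hZ hX
  have h3 := key hZ hX hY
  have hj : VectorField.mlieBracket (𝓡 4) X (VectorField.mlieBracket (𝓡 4) Y Z)
      + VectorField.mlieBracket (𝓡 4) Y (VectorField.mlieBracket (𝓡 4) Z X)
      + VectorField.mlieBracket (𝓡 4) Z (VectorField.mlieBracket (𝓡 4) X Y) = 0 := by
    ext1 x
    have neg : VectorField.mlieBracket (𝓡 4) Y (VectorField.mlieBracket (𝓡 4) Z X) x =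
        - VectorField.mlieBracket (𝓡 4) Y (VectorField.mlieBracket (𝓡 4) X Z) x := by
      rw [VectorField.mlieBracket_swap (V := Z) (W := X)]
      have := VectorField.mlieBracket_const_smul_right (V := Y) (c := (-1 : ℝ))
        ((hX.bracket hZ).mdiffAt x)
      simpa using this
    simp only [Pi.add_apply, mlieBracket_jacobi hX hY hZ x, neg, Pi.zero_apply,
      VectorField.mlieBracket_swap_apply (V := Z)]
    abel
  rw [← hj, ← h1, ← h2, ← h3]
  simp only [curv]
  abel

end LeviCivita

end

section

/-! ### Complex calculus -/

section Calculus

variable {M : Type*} [TopologicalSpace M] [ChartedSpace (EuclideanSpace ℝ (Fin 4)) M]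

theorem mvfderiv_clm_comp {F F' : Type*} [NormedAddCommGroup F] [NormedSpace ℝ F]
    [NormedAddCommGroup F'] [NormedSpace ℝ F'] (L : F →L[ℝ] F') {f : M → F} {x : M}
    (hf : MDifferentiableAt (𝓡 4) 𝓘(ℝ, F) f x) (v : TangentSpace (𝓡 4) x) :
    mvfderiv (𝓡 4) (fun y ↦ L (f y)) x v = L (mvfderiv (𝓡 4) f x v) := by
  have h : HasMFDerivAt (𝓡 4) 𝓘(ℝ, F') (L ∘ f) x
      (L.comp (mvfderiv (𝓡 4) f x)) :=
    HasMFDerivAt.comp x L.hasMFDerivAt hf.hasMFDerivAt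
  have h' := h.mfderiv
  change (mfderiv (𝓡 4) 𝓘(ℝ, F') (L ∘ f) x) v = _
  rw [h']
  rfl

theorem mvfderiv_complex_mul {f h : M → ℂ} {x : M}
    (hf : MDifferentiableAt (𝓡 4) 𝓘(ℝ, ℂ) f x) (hh : MDifferentiableAt (𝓡 4) 𝓘(ℝ, ℂ) h x)
    (v : TangentSpace (𝓡 4) x) :
    mvfderiv (𝓡 4) (f * h) x v
      = f x * mvfderiv (𝓡 4) h x v + mvfderiv (𝓡 4) f x v * h x := by
  have h' := (hf.hasMFDerivAt.mul' hh.hasMFDerivAt).mfderiv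
  change (mfderiv (𝓡 4) 𝓘(ℝ, ℂ) (f * h) x) v = _
  rw [h']
  rfl

theorem mvfderiv_complex_mk {a b : M → ℝ} {x : M} (ha : MDifferentiableAt (𝓡 4) 𝓘(ℝ) a x)
    (hb : MDifferentiableAt (𝓡 4) 𝓘(ℝ) b x) (v : TangentSpace (𝓡 4) x) :
    mvfderiv (𝓡 4) (fun y ↦ (a y : ℂ) + Complex.I * (b y : ℂ)) x v =
      (mvfderiv (𝓡 4) a x v : ℝ) + Complex.I * (mvfderiv (𝓡 4) b x v : ℝ) := by
  let L : ℝ →L[ℝ] ℂ := (ContinuousLinearMap.mul ℝ ℂ Complex.I).comp Complex.ofRealCLM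
  have h1 := mvfderiv_clm_comp Complex.ofRealCLM ha v
  have h2 := mvfderiv_clm_comp L hb v
  have h3 := mvfderiv_fun_add
    (Complex.ofRealCLM.mdifferentiableAt.comp x ha) (L.mdifferentiableAt.comp x hb)
  have h4 := congrArg (· v) h3
  simp only [add_apply] at h4
  refine Eq.trans ?_ (h4.trans (congrArg₂ (· + ·) h1 h2))
  rfl

/-- The ring of smooth complex functions. -/
def smoothRing (M : Type*) [TopologicalSpace M] [ChartedSpace (EuclideanSpace ℝ (Fin 4)) M] :
    Subring (M → ℂ) where
  carrier := {f | ContMDiff (𝓡 4) 𝓘(ℝ, ℂ) ∞ f}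
  mul_mem' hf hh := (contDiff_mul (𝕜 := ℝ) (𝔸 := ℂ)).contMDiff.comp (hf.prodMk_space hh)
  one_mem' := contMDiff_const
  add_mem' hf hh := ContMDiff.add hf hh
  zero_mem' := contMDiff_const
  neg_mem' hf := ContMDiff.neg hf

theorem smoothRing.mdiffAt (f : smoothRing M) (x : M) :
    MDifferentiableAt (𝓡 4) 𝓘(ℝ, ℂ) (f : M → ℂ) x :=
  (f.2 x).mdifferentiableAt (by simp)

theorem const_mem_smoothRing (c : ℂ) : (fun _ ↦ c : M → ℂ) ∈ smoothRing M := contMDiff_const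

theorem ofReal_mem_smoothRing {a : M → ℝ} (ha : ContMDiff (𝓡 4) 𝓘(ℝ) ∞ a) :
    (fun x ↦ (a x : ℂ)) ∈ smoothRing M :=
  Complex.ofRealCLM.contMDiff.comp ha

theorem conj_mem_smoothRing {f : M → ℂ} (hf : f ∈ smoothRing M) :
    (fun x ↦ (starRingEnd ℂ) (f x)) ∈ smoothRing M :=
  Complex.conjCLE.toContinuousLinearMap.contMDiff.comp hf

namespace CVectorField

theorem deriv_add (V : CVectorField M) {f h : M → ℂ} (hf : f ∈ smoothRing M)
    (hh : h ∈ smoothRing M) (x : M) : V.deriv (f + h) x = V.deriv f x + V.deriv h x := by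
  simp only [deriv, mvfderiv_add (smoothRing.mdiffAt ⟨f, hf⟩ x) (smoothRing.mdiffAt ⟨h, hh⟩ x),
    add_apply]
  ring

theorem deriv_mul (V : CVectorField M) {f h : M → ℂ} (hf : f ∈ smoothRing M)
    (hh : h ∈ smoothRing M) (x : M) :
    V.deriv (f * h) x = f x * V.deriv h x + h x * V.deriv f x := by
  simp only [deriv,
    mvfderiv_complex_mul (smoothRing.mdiffAt ⟨f, hf⟩ x) (smoothRing.mdiffAt ⟨h, hh⟩ x)]
  ring

theorem deriv_const (V : CVectorField M) (c : ℂ) (x : M) : V.deriv (fun _ ↦ c) x = 0 := by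
  simp [deriv, mvfderiv_const]

end CVectorField

end Calculus

variable {M : Type*} [TopologicalSpace M] [ChartedSpace (EuclideanSpace ℝ (Fin 4)) M]
  [IsManifold (𝓡 4) ∞ M]

namespace CVectorField

/-- Smoothness of a complex vector field. -/
def Smooth (V : CVectorField M) : Prop := SmoothVF V.re ∧ SmoothVF V.im

theorem Smooth.conj {V : CVectorField M} (hV : V.Smooth) : V.conj.Smooth := ⟨hV.1, hV.2.neg⟩

theorem Smooth.deriv_mem {V : CVectorField M} (hV : V.Smooth) {f : M → ℂ}
    (hf : f ∈ smoothRing M) : V.deriv f ∈ smoothRing M :=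
  add_mem (SmoothVF.deriv hf hV.1)
    (mul_mem (const_mem_smoothRing Complex.I) (SmoothVF.deriv hf hV.2))

/-- A smooth complex vector field as a derivation of the ring of smooth functions. -/
def derivation (V : CVectorField M) (hV : V.Smooth) :
    Derivation ℤ (smoothRing M) (smoothRing M) :=
  Derivation.mk'
    (AddMonoidHom.toIntLinearMap
      { toFun := fun f ↦ ⟨V.deriv f, hV.deriv_mem f.2⟩
        map_zero' := by ext x; exact V.deriv_const 0 x
        map_add' := fun f h ↦ by ext x; exact V.deriv_add f.2 h.2 x })
    fun f h ↦ by ext x; exact V.deriv_mul f.2 h.2 x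

end CVectorField

theorem mvfderiv_mlieBracket_complex {X Y Z : ∀ x : M, TangentSpace (𝓡 4) x} (hX : SmoothVF X)
    (hY : SmoothVF Y) (hZ : SmoothVF Z) (x : M) (hZx : Z x ≠ 0) {f : M → ℂ}
    (hf : f ∈ smoothRing M) :
    mvfderiv (𝓡 4) f x (VectorField.mlieBracket (𝓡 4) X Y x) =
      mvfderiv (𝓡 4) (fun y ↦ mvfderiv (𝓡 4) f y (Y y)) x (X x)
        - mvfderiv (𝓡 4) (fun y ↦ mvfderiv (𝓡 4) f y (X y)) x (Y x) := by
  have key : ∀ L : ℂ →L[ℝ] ℝ, L (mvfderiv (𝓡 4) f x (VectorField.mlieBracket (𝓡 4) X Y x)) =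
      L (mvfderiv (𝓡 4) (fun y ↦ mvfderiv (𝓡 4) f y (Y y)) x (X x))
        - L (mvfderiv (𝓡 4) (fun y ↦ mvfderiv (𝓡 4) f y (X y)) x (Y x)) := by
    intro L
    have hd := fun y ↦ smoothRing.mdiffAt ⟨f, hf⟩ y
    have h1 := fun (W : ∀ x : M, TangentSpace (𝓡 4) x) (hW : SmoothVF W) ↦
      smoothRing.mdiffAt ⟨_, SmoothVF.deriv hf hW⟩ x
    have := mvfderiv_mlieBracket hX hY hZ x hZx (f := fun y ↦ L (f y)) (L.contMDiff.comp hf)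
    simp only [mvfderiv_clm_comp L (hd _)] at this
    rwa [mvfderiv_clm_comp L (h1 X hX), mvfderiv_clm_comp L (h1 Y hY)] at this
  apply Complex.ext
  · simpa using key Complex.reCLM
  · simpa using key Complex.imCLM

/-- The bracket of complex vector fields acts on functions as the commutator. -/
theorem SpinDyad.deriv_bracket {g : LorentzMetric M} (d : SpinDyad g) {V W : CVectorField M}
    (hV : V.Smooth) (hW : W.Smooth) {f : M → ℂ} (hf : f ∈ smoothRing M) (x : M) :
    (V.bracket W).deriv f x = V.deriv (W.deriv f) x - W.deriv (V.deriv f) x := by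
  have e : ∀ {U : CVectorField M}, U.Smooth → ∀ v, mvfderiv (𝓡 4) (U.deriv f) x v
      = mvfderiv (𝓡 4) (fun y ↦ mvfderiv (𝓡 4) f y (U.re y)) x v
        + Complex.I * mvfderiv (𝓡 4) (fun y ↦ mvfderiv (𝓡 4) f y (U.im y)) x v := by
    rintro U ⟨hX, hY⟩ v
    have h1 := smoothRing.mdiffAt ⟨_, SmoothVF.deriv hf hX⟩ x
    have h2 := smoothRing.mdiffAt ⟨_, SmoothVF.deriv hf hY⟩ x
    have hI := smoothRing.mdiffAt ⟨_, const_mem_smoothRing (M := M) Complex.I⟩ x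
    have h3 := smoothRing.mdiffAt ⟨_, mul_mem (const_mem_smoothRing (M := M) Complex.I)
      (SmoothVF.deriv hf hY)⟩ x
    have a := congrArg (· v) (mvfderiv_add h1 h3)
    have b := mvfderiv_complex_mul hI h2 v
    simp only [mvfderiv_const, add_apply, b, zero_apply, zero_mul, add_zero] at a
    exact a
  have br := fun {X Y : ∀ x : M, TangentSpace (𝓡 4) x} (hX : SmoothVF X) (hY : SmoothVF Y) ↦
    mvfderiv_mlieBracket_complex hX hY d.smooth_l x (d.lre_ne_zero x) hf
  have un : ∀ (U : CVectorField M) (h : M → ℂ), U.deriv h x =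
      mvfderiv (𝓡 4) h x (U.re x) + Complex.I * mvfderiv (𝓡 4) h x (U.im x) := fun _ _ ↦ rfl
  rw [un, un V, un W]
  simp only [CVectorField.bracket, map_sub, map_add]
  rw [e hW, e hW, e hV, e hV, br hV.1 hW.1, br hV.2 hW.2,
    br hV.1 hW.2, br hV.2 hW.1]
  linear_combination (mvfderiv (𝓡 4) (fun y ↦ mvfderiv (𝓡 4) f y (V.im y)) x (W.im x)
    - mvfderiv (𝓡 4) (fun y ↦ mvfderiv (𝓡 4) f y (W.im y)) x (V.im x)) * Complex.I_sq

end

section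

variable {M : Type*} [TopologicalSpace M] [ChartedSpace (EuclideanSpace ℝ (Fin 4)) M]
  [IsManifold (𝓡 4) ∞ M]

/-! ### The complexified Levi-Civita connection -/

variable {g : LorentzMetric M} {nab : AffineConnection M} {V W Z U : CVectorField M}

theorem cval_symm (V W : CVectorField M) (x : M) : g.cval V W x = g.cval W V x := by
  simp only [LorentzMetric.cval, g.symm x (V.re x), g.symm x (V.im x)]
  rw [add_comm (g.val x (W.im x) (V.re x))]

theorem CVectorField.Smooth.cval_mem (hV : V.Smooth) (hW : W.Smooth) :
    g.cval V W ∈ smoothRing M :=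
  add_mem (ofReal_mem_smoothRing ((hV.1.metric g hW.1).sub (hV.2.metric g hW.2)))
    (mul_mem (const_mem_smoothRing Complex.I)
      (ofReal_mem_smoothRing ((hV.1.metric g hW.2).add (hV.2.metric g hW.1))))

theorem IsLeviCivita.smooth_ccov (hLC : IsLeviCivita g nab) (d : SpinDyad g) (hV : V.Smooth)
    (hW : W.Smooth) : (ccov nab V W).Smooth :=
  ⟨(hLC.smooth_cov d hV.1 hW.1).sub (hLC.smooth_cov d hV.2 hW.2),
    (hLC.smooth_cov d hV.1 hW.2).add (hLC.smooth_cov d hV.2 hW.1)⟩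

/-- Metric compatibility. -/
theorem IsLeviCivita.deriv_cval (hLC : IsLeviCivita g nab) (V : CVectorField M)
    (hW : W.Smooth) (hZ : Z.Smooth) (x : M) :
    V.deriv (g.cval W Z) x = g.cval (ccov nab V W) Z x + g.cval W (ccov nab V Z) x := by
  have md : ∀ {X Y : ∀ x : M, TangentSpace (𝓡 4) x}, SmoothVF X → SmoothVF Y →
      MDifferentiableAt (𝓡 4) 𝓘(ℝ) (fun y ↦ g.val y (X y) (Y y)) x :=
    fun hX hY ↦ (hX.metric g hY x).mdifferentiableAt (by simp)
  have mt : ∀ {X Y : ∀ x : M, TangentSpace (𝓡 4) x}, SmoothVF X → SmoothVF Y → ∀ v,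
      mvfderiv (𝓡 4) (fun y ↦ g.val y (X y) (Y y)) x v =
        g.val x (nab X x v) (Y x) + g.val x (X x) (nab Y x v) :=
    fun hX hY v ↦ hLC.metric _ _ x v (hX.mdiffAt x) (hY.mdiffAt x)
  have key : ∀ v, mvfderiv (𝓡 4) (g.cval W Z) x v =
      ((g.val x (nab W.re x v) (Z.re x) + g.val x (W.re x) (nab Z.re x v)
        - (g.val x (nab W.im x v) (Z.im x) + g.val x (W.im x) (nab Z.im x v)) : ℝ) : ℂ)
      + Complex.I * ((g.val x (nab W.re x v) (Z.im x) + g.val x (W.re x) (nab Z.im x v)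
        + (g.val x (nab W.im x v) (Z.re x) + g.val x (W.im x) (nab Z.re x v)) : ℝ) : ℂ) := by
    intro v
    rw [← mt hW.1 hZ.1, ← mt hW.2 hZ.2, ← mt hW.1 hZ.2, ← mt hW.2 hZ.1]
    have h1 := mvfderiv_complex_mk ((md hW.1 hZ.1).sub (md hW.2 hZ.2))
      ((md hW.1 hZ.2).add (md hW.2 hZ.1)) v
    have h2 := congrArg (· v) (mvfderiv_sub (md hW.1 hZ.1) (md hW.2 hZ.2))
    have h3 := congrArg (· v) (mvfderiv_add (md hW.1 hZ.2) (md hW.2 hZ.1))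
    simp only [add_apply, sub_apply] at h2 h3
    rw [h2, h3] at h1
    exact h1
  simp only [CVectorField.deriv, key, LorentzMetric.cval, ccov, map_sub, map_add, sub_apply,
    add_apply]
  apply Complex.ext <;> simp <;> ring

/-- `V` is the sum of its tetrad components, as seen by any linear form. -/
theorem SpinDyad.expand_form (d : SpinDyad g) (x : M) (φ : TangentSpace (𝓡 4) x →ₗ[ℝ] ℂ)
    (V : CVectorField M) :
    φ (V.re x) + Complex.I * φ (V.im x) = ∑ C : Fin 2, ∑ C' : Fin 2, ∑ D : Fin 2, ∑ D' : Fin 2,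
      eps C D * eps C' D' * g.cval V (d.tet D D') x
        * (φ ((d.tet C C').re x) + Complex.I * φ ((d.tet C C').im x)) := by
  have h1 := congrArg φ (d.expand x (V.re x))
  have h2 := congrArg φ (d.expand x (V.im x))
  simp only [map_add, map_sub, map_smul, Complex.real_smul] at h1 h2
  rw [h1, h2]
  simp only [Fin.sum_univ_two, eps, tet, l, n, m, mbar, CVectorField.conj, LorentzMetric.cval]
  simp
  linear_combination (-2 * φ (d.mim x) * (g.val x (V.re x) (d.mim x) : ℝ)) * Complex.I_sq

theorem SpinDyad.cval_expand (d : SpinDyad g) (x : M) (V W : CVectorField M) :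
    g.cval V W x = ∑ C : Fin 2, ∑ C' : Fin 2, ∑ D : Fin 2, ∑ D' : Fin 2,
      eps C D * eps C' D' * g.cval V (d.tet D D') x * g.cval (d.tet C C') W x := by
  let φ : TangentSpace (𝓡 4) x →ₗ[ℝ] ℂ :=
    { toFun := fun v ↦ (g.val x v (W.re x) : ℂ) + Complex.I * (g.val x v (W.im x) : ℂ)
      map_add' := fun v w ↦ by simp; ring
      map_smul' := fun c v ↦ by simp; ring }
  have e : ∀ V : CVectorField M, g.cval V W x = φ (V.re x) + Complex.I * φ (V.im x) := by
    intro V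
    simp only [φ, LorentzMetric.cval]
    apply Complex.ext <;> simp [sub_eq_add_neg]
  simp only [e _]
  exact d.expand_form x φ V

theorem SpinDyad.deriv_expand (d : SpinDyad g) (x : M) (V : CVectorField M) (f : M → ℂ) :
    V.deriv f x = ∑ C : Fin 2, ∑ C' : Fin 2, ∑ D : Fin 2, ∑ D' : Fin 2,
      eps C D * eps C' D' * g.cval V (d.tet D D') x * (d.tet C C').deriv f x :=
  d.expand_form x (mvfderiv (𝓡 4) f x).toLinearMap V

theorem SpinDyad.ccov_expand (d : SpinDyad g) (x : M) (V Z U : CVectorField M) :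
    g.cval (ccov nab V Z) U x = ∑ C : Fin 2, ∑ C' : Fin 2, ∑ D : Fin 2, ∑ D' : Fin 2,
      eps C D * eps C' D' * g.cval V (d.tet D D') x * g.cval (ccov nab (d.tet C C') Z) U x := by
  let φ : TangentSpace (𝓡 4) x →ₗ[ℝ] ℂ :=
    { toFun := fun v ↦
        ((g.val x (nab Z.re x v) (U.re x) - g.val x (nab Z.im x v) (U.im x) : ℝ) : ℂ)
        + Complex.I * ((g.val x (nab Z.re x v) (U.im x) + g.val x (nab Z.im x v) (U.re x) : ℝ) : ℂ)
      map_add' := fun v w ↦ by simp; ring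
      map_smul' := fun c v ↦ by simp; ring }
  have e : ∀ V : CVectorField M,
      g.cval (ccov nab V Z) U x = φ (V.re x) + Complex.I * φ (V.im x) := by
    intro V
    simp only [φ, LorentzMetric.cval, ccov]
    apply Complex.ext <;> simp <;> ring
  simp only [e _]
  exact d.expand_form x φ V

/-- Vanishing torsion. -/
theorem IsLeviCivita.cval_bracket (hLC : IsLeviCivita g nab) (hV : V.Smooth) (hW : W.Smooth)
    (U : CVectorField M) (x : M) :
    g.cval (V.bracket W) U x = g.cval (ccov nab V W) U x - g.cval (ccov nab W V) U x := by
  have t : ∀ {X Y : ∀ x : M, TangentSpace (𝓡 4) x}, SmoothVF X → SmoothVF Y →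
      VectorField.mlieBracket (𝓡 4) X Y x = nab Y x (X x) - nab X x (Y x) :=
    fun hX hY ↦ (hLC.torsion_free _ _ x (hX.mdiffAt x) (hY.mdiffAt x)).symm
  simp only [LorentzMetric.cval, CVectorField.bracket, ccov, t hV.1 hW.1, t hV.2 hW.2,
    t hV.1 hW.2, t hV.2 hW.1, map_sub, map_add, sub_apply, add_apply]
  push_cast
  ring

theorem riemann_swap_left (V W Z U : CVectorField M) (x : M) :
    riemann g nab W V Z U x = - riemann g nab V W Z U x := by
  have h : g.cval (ccov nab (W.bracket V) Z) U x = - g.cval (ccov nab (V.bracket W) Z) U x := by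
    simp only [LorentzMetric.cval, CVectorField.bracket, ccov,
      VectorField.mlieBracket_swap_apply (V := W.re),
      VectorField.mlieBracket_swap_apply (V := W.im),
      map_sub, map_add, map_neg, sub_apply, add_apply, neg_apply]
    push_cast
    ring
  rw [riemann, riemann, h]
  ring

theorem IsLeviCivita.riemann_swap_right (hLC : IsLeviCivita g nab) (d : SpinDyad g)
    (hV : V.Smooth) (hW : W.Smooth) (hZ : Z.Smooth) (hU : U.Smooth) (x : M) :
    riemann g nab V W U Z x = - riemann g nab V W Z U x := by
  have sm := fun {V W : CVectorField M} (hV : V.Smooth) (hW : W.Smooth) ↦ hLC.smooth_ccov d hV hW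
  have h := d.deriv_bracket hV hW (hZ.cval_mem (g := g) hU) x
  have e : ∀ V : CVectorField M, V.deriv (g.cval Z U) =
      g.cval (ccov nab V Z) U + g.cval Z (ccov nab V U) :=
    fun V ↦ funext fun x ↦ hLC.deriv_cval V hZ hU x
  rw [e, e, e, CVectorField.deriv_add _ ((sm hW hZ).cval_mem hU) (hZ.cval_mem (sm hW hU)),
    CVectorField.deriv_add _ ((sm hV hZ).cval_mem hU) (hZ.cval_mem (sm hV hU)),
    hLC.deriv_cval V (sm hW hZ) hU, hLC.deriv_cval V hZ (sm hW hU),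
    hLC.deriv_cval W (sm hV hZ) hU, hLC.deriv_cval W hZ (sm hV hU)] at h
  simp only [Pi.add_apply, cval_symm Z] at h
  rw [riemann, riemann]
  linear_combination -h

theorem IsLeviCivita.riemann_eq (hLC : IsLeviCivita g nab) (d : SpinDyad g)
    (hV : V.Smooth) (hW : W.Smooth) (hZ : Z.Smooth) (U : CVectorField M) (x : M) :
    riemann g nab V W Z U x = g.cval
      ⟨curv nab V.re W.re Z.re - curv nab V.im W.im Z.re - curv nab V.re W.im Z.im
        - curv nab V.im W.re Z.im,
       curv nab V.re W.re Z.im - curv nab V.im W.im Z.im + curv nab V.re W.im Z.re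
        + curv nab V.im W.re Z.re⟩ U x := by
  have sm := fun {X Y : ∀ x : M, TangentSpace (𝓡 4) x} (hX : SmoothVF X) (hY : SmoothVF Y) ↦
    hLC.smooth_cov d hX hY
  have e1 : ∀ {V W : CVectorField M}, W.Smooth → ∀ v,
      nab (ccov nab W Z).re x v = nab (cov nab W.re Z.re) x v - nab (cov nab W.im Z.im) x v :=
    fun hW v ↦ nab_sub (sm hW.1 hZ.1) (sm hW.2 hZ.2) x v
  have e2 : ∀ {V W : CVectorField M}, W.Smooth → ∀ v,
      nab (ccov nab W Z).im x v = nab (cov nab W.re Z.im) x v + nab (cov nab W.im Z.re) x v :=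
    fun hW v ↦ nab_add (sm hW.1 hZ.2) (sm hW.2 hZ.1) x v
  have u : ∀ (V Y : CVectorField M), g.cval (ccov nab V Y) U x = 
    ((g.val x (nab Y.re x (V.re x) - nab Y.im x (V.im x)) (U.re x)
      - g.val x (nab Y.im x (V.re x) + nab Y.re x (V.im x)) (U.im x) : ℝ) : ℂ)
    + Complex.I * ((g.val x (nab Y.re x (V.re x) - nab Y.im x (V.im x)) (U.im x)
      + g.val x (nab Y.im x (V.re x) + nab Y.re x (V.im x)) (U.re x) : ℝ) : ℂ) :=
    fun _ _ ↦ rfl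
  rw [riemann, u, u W, u, e1 (V := V) hW, e1 (V := V) hV, e2 (V := V) hW, e2 (V := V) hV,
    e1 (V := V) hW, e1 (V := V) hV, e2 (V := V) hW, e2 (V := V) hV]
  simp only [LorentzMetric.cval, CVectorField.bracket, curv, Pi.sub_apply, Pi.add_apply, cov,
    map_sub, map_add, sub_apply, add_apply]
  push_cast
  ring

theorem IsLeviCivita.riemann_cyclic (hLC : IsLeviCivita g nab) (d : SpinDyad g)
    (hV : V.Smooth) (hW : W.Smooth) (hZ : Z.Smooth) (U : CVectorField M) (x : M) :
    riemann g nab V W Z U x + riemann g nab W Z V U x + riemann g nab Z V W U x = 0 := by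
  have b := fun {X Y Z : ∀ x : M, TangentSpace (𝓡 4) x} (hX : SmoothVF X) (hY : SmoothVF Y)
    (hZ : SmoothVF Z) (u : TangentSpace (𝓡 4) x) ↦
    congrArg (fun X ↦ g.val x (X x) u) (hLC.bianchi d hX hY hZ)
  simp only [Pi.add_apply, map_add, add_apply, Pi.zero_apply, map_zero, zero_apply] at b
  rw [hLC.riemann_eq d hV hW hZ, hLC.riemann_eq d hW hZ hV, hLC.riemann_eq d hZ hV hW]
  simp only [LorentzMetric.cval, Pi.sub_apply, Pi.add_apply, map_sub, map_add, sub_apply,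
    add_apply]
  apply Complex.ext
  · simp
    linarith [b hV.1 hW.1 hZ.1 (U.re x), b hV.2 hW.2 hZ.1 (U.re x), b hV.1 hW.2 hZ.2 (U.re x),
      b hV.2 hW.1 hZ.2 (U.re x), b hV.1 hW.1 hZ.2 (U.im x), b hV.2 hW.2 hZ.2 (U.im x),
      b hV.1 hW.2 hZ.1 (U.im x), b hV.2 hW.1 hZ.1 (U.im x)]
  · simp
    linarith [b hV.1 hW.1 hZ.1 (U.im x), b hV.2 hW.2 hZ.1 (U.im x), b hV.1 hW.2 hZ.2 (U.im x),
      b hV.2 hW.1 hZ.2 (U.im x), b hV.1 hW.1 hZ.2 (U.re x), b hV.2 hW.2 hZ.2 (U.re x),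
      b hV.1 hW.2 hZ.1 (U.re x), b hV.2 hW.1 hZ.1 (U.re x)]

/-- The pair symmetry `R_{abcd} = R_{cdab}`. -/
theorem IsLeviCivita.riemann_pair (hLC : IsLeviCivita g nab) (d : SpinDyad g)
    (hV : V.Smooth) (hW : W.Smooth) (hZ : Z.Smooth) (hU : U.Smooth) (x : M) :
    riemann g nab V W Z U x = riemann g nab Z U V W x := by
  have c1 := hLC.riemann_cyclic d hV hW hZ U x
  have c2 := hLC.riemann_cyclic d hW hZ hU V x
  have c3 := hLC.riemann_cyclic d hZ hU hV W x
  have c4 := hLC.riemann_cyclic d hU hV hW Z x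
  have s := fun {V W Z U : CVectorField M} (hV : V.Smooth) (hW : W.Smooth) (hZ : Z.Smooth)
    (hU : U.Smooth) ↦ hLC.riemann_swap_right d hV hW hZ hU x
  rw [s hW hZ hV hU, s hZ hU hV hW] at c2
  rw [riemann_swap_left Z V U W, s hZ hV hW hU] at c3
  rw [s hU hV hZ hW, s hV hW hZ hU, riemann_swap_left U W V Z, s hU hW hZ hV] at c4
  linear_combination (1 / 2) * (c1 + c2 - c3 - c4)

end

section

/-! ### Spin frames over a commutative ring -/

/-- The connection data of a torsion-free spin connection in a dyad: four derivations
`D_{AA'}` of a ring of functions and the connection coefficients `γ_{AA'B}{}^C`,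
`γ̄_{AA'B'}{}^{C'}` on `S` and `S'`. -/
structure SpinFrame (K : Type*) [CommRing K] where
  D : Fin 2 → Fin 2 → Derivation ℤ K K
  γ : Fin 2 → Fin 2 → Fin 2 → Fin 2 → K
  γP : Fin 2 → Fin 2 → Fin 2 → Fin 2 → K
  γ_traceless : ∀ A A', γ A A' 1 1 = -γ A A' 0 0
  γP_traceless : ∀ A A', γP A A' 1 1 = -γP A A' 0 0
  comm : ∀ A A' B B' f, D A A' (D B B' f) - D B B' (D A A' f) =
    ∑ C, (γ A A' B C * D C B' f + γP A A' B' C * D B C f)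
      - ∑ C, (γ B B' A C * D C A' f + γP B B' A' C * D A C f)

/-- The curvature of the connection with matrix-valued connection form `N`. -/
def SpinFrame.curv {K : Type*} [CommRing K] (S : SpinFrame K)
    (N : Fin 2 → Fin 2 → Fin 2 → Fin 2 → K) (A A' B B' C E : Fin 2) : K :=
  S.D A A' (N B B' C E) - S.D B B' (N A A' C E)
    + ∑ F, (N B B' C F * N A A' F E - N A A' C F * N B B' F E)
    - (∑ F, (S.γ A A' B F * N F B' C E + S.γP A A' B' F * N B F C E)
      - ∑ F, (S.γ B B' A F * N F A' C E + S.γP B B' A' F * N A F C E))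

/-- Decomposition of an antisymmetric tensor `G_{BB'DD'}` into its two spinor traces. -/
theorem antisymm_decomp (G : Fin 2 → Fin 2 → Fin 2 → Fin 2 → ℂ)
    (h : ∀ B B' C C', G B B' C C' = -G C C' B B') (B B' D D' : Fin 2) :
    G B B' D D' =
      (∑ C, ((1 / 2) * ∑ B' : Fin 2, ∑ D : Fin 2, ∑ D' : Fin 2,
        eps C D * eps B' D' * G B B' D D') * eps C D) * eps B' D'
      + (∑ C, ((1 / 2) * ∑ B : Fin 2, ∑ D' : Fin 2, ∑ D : Fin 2,
        eps C D' * eps B D * G B B' D D') * eps C D') * eps B D := by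
  have h0 : ∀ B B', G B B' B B' = 0 := fun B B' ↦ by linear_combination (1 / 2) * h B B' B B'
  have h1 := h 0 1 0 0
  have h2 := h 1 0 0 0
  have h3 := h 1 1 0 0
  have h4 := h 1 0 0 1
  have h5 := h 1 1 0 1
  have h6 := h 1 1 1 0
  simp only [Fin.sum_univ_two]
  fin_cases B <;> fin_cases B' <;> fin_cases D <;> fin_cases D' <;>
    simp [eps, h0, h1, h2, h3, h4, h5, h6] <;> ring

variable {M : Type*} [TopologicalSpace M] [ChartedSpace (EuclideanSpace ℝ (Fin 4)) M]
  [IsManifold (𝓡 4) ∞ M]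

namespace SpinDyad

variable {g : LorentzMetric M} (d : SpinDyad g) {nab : AffineConnection M}

theorem smooth_tet (A A' : Fin 2) : (d.tet A A').Smooth := by
  fin_cases A <;> fin_cases A'
  · exact ⟨d.smooth_l, SmoothVF.zero⟩
  · exact ⟨d.smooth_mre, d.smooth_mim⟩
  · exact CVectorField.Smooth.conj (V := d.m) ⟨d.smooth_mre, d.smooth_mim⟩
  · exact ⟨d.smooth_n, SmoothVF.zero⟩

theorem tet_conj (A A' : Fin 2) : (d.tet A A').conj = d.tet A' A := by
  fin_cases A <;> fin_cases A' <;>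
    simp [tet, CVectorField.conj, l, n, mbar, m] <;> rfl

theorem cval_tet (A A' B B' : Fin 2) (x : M) :
    g.cval (d.tet A A') (d.tet B B') x = eps A B * eps A' B' := by
  obtain ⟨h1, h2, h3, h4, h5, h6, h7⟩ := d.real_relations x
  have h1' := g.symm x (d.mre x) (d.lre x)
  have h2' := g.symm x (d.mim x) (d.lre x)
  have h3' := g.symm x (d.mre x) (d.nre x)
  have h4' := g.symm x (d.mim x) (d.nre x)
  have h5' := g.symm x (d.mim x) (d.mre x)
  have h8' := g.symm x (d.nre x) (d.lre x)
  rw [h1] at h1'; rw [h2] at h2'; rw [h3] at h3'; rw [h4] at h4'; rw [h5] at h5'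
  rw [d.ln] at h8'
  fin_cases A <;> fin_cases A' <;> fin_cases B <;> fin_cases B' <;>
    simp [tet, CVectorField.conj, l, n, mbar, m, LorentzMetric.cval, eps, d.ll, d.nn, d.ln,
      h1, h2, h3, h4, h5, h6, h7, h1', h2', h3', h4', h5', h8']

theorem cval_ccov_swap (hLC : IsLeviCivita g nab) (V : CVectorField M) (B B' C C' : Fin 2)
    (x : M) : g.cval (ccov nab V (d.tet B B')) (d.tet C C') x =
      -g.cval (ccov nab V (d.tet C C')) (d.tet B B') x := by
  have h := hLC.deriv_cval V (d.smooth_tet B B') (d.smooth_tet C C') x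
  rw [funext (d.cval_tet B B' C C'), CVectorField.deriv_const, cval_symm (d.tet B B')] at h
  linear_combination -h

theorem cval_ccov_conj {V W U : CVectorField M} (hW : W.Smooth) (x : M) :
    g.cval (ccov nab V.conj W.conj) U.conj x =
      (starRingEnd ℂ) (g.cval (ccov nab V W) U x) := by
  have h : ∀ v, nab (fun y ↦ -W.im y) x v = -nab W.im x v := by
    intro v
    have := nab_sub (nab := nab) SmoothVF.zero hW.2 x v
    rw [zero_sub, CovariantDerivative.zero] at this
    rwa [Pi.zero_apply, zero_apply, zero_sub] at this
  apply Complex.ext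
  · simp [LorentzMetric.cval, CVectorField.conj, ccov, h]
    ring
  · simp [LorentzMetric.cval, CVectorField.conj, ccov, h]
    ring

theorem cval_ccov_tet_conj (A A' B B' C C' : Fin 2) (x : M) :
    (starRingEnd ℂ) (g.cval (ccov nab (d.tet A A') (d.tet B B')) (d.tet C C') x) =
      g.cval (ccov nab (d.tet A' A) (d.tet B' B)) (d.tet C' C) x := by
  rw [← cval_ccov_conj (d.smooth_tet B B'), tet_conj, tet_conj, tet_conj]

theorem spinConnP_eq (A A' B' C' : Fin 2) (x : M) : d.spinConnP nab A A' B' C' x =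
    (1 / 2) * ∑ B : Fin 2, ∑ D' : Fin 2, ∑ D : Fin 2,
      eps C' D' * eps B D * g.cval (ccov nab (d.tet A A') (d.tet B B')) (d.tet D D') x := by
  have he : ∀ a b, (starRingEnd ℂ) (eps a b) = eps a b := by
    intro a b
    fin_cases a <;> fin_cases b <;> simp [eps]
  simp only [spinConnP, spinConn, map_mul, map_sum, he, cval_ccov_tet_conj]
  rw [map_div₀, map_one, map_ofNat]

/-- The Levi-Civita connection is induced by the spin connection. -/
theorem cval_ccov_tet (hLC : IsLeviCivita g nab) (A A' B B' D D' : Fin 2) (x : M) :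
    g.cval (ccov nab (d.tet A A') (d.tet B B')) (d.tet D D') x =
      (∑ C, d.spinConn nab A A' B C x * eps C D) * eps B' D'
        + (∑ C, d.spinConnP nab A A' B' C x * eps C D') * eps B D := by
  simp only [spinConnP_eq, spinConn]
  exact antisymm_decomp
    (fun B B' C C' ↦ g.cval (ccov nab (d.tet A A') (d.tet B B')) (d.tet C C') x)
    (fun B B' C C' ↦ d.cval_ccov_swap hLC (d.tet A A') B B' C C' x) B B' D D'

theorem spinConn_traceless (hLC : IsLeviCivita g nab) (A A' : Fin 2) (x : M) :
    d.spinConn nab A A' 1 1 x = -d.spinConn nab A A' 0 0 x := by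
  have h := fun B B' C C' ↦ d.cval_ccov_swap hLC (d.tet A A') B B' C C' x
  simp only [spinConn, eps, Fin.sum_univ_two]
  simp
  linear_combination (1 / 2) * h 1 1 0 0 - (1 / 2) * h 1 0 0 1

theorem spinConnP_traceless (hLC : IsLeviCivita g nab) (A A' : Fin 2) (x : M) :
    d.spinConnP nab A A' 1 1 x = -d.spinConnP nab A A' 0 0 x := by
  rw [spinConnP, spinConnP, d.spinConn_traceless hLC, map_neg]

end SpinDyad

end

section

variable {M : Type*} [TopologicalSpace M] [ChartedSpace (EuclideanSpace ℝ (Fin 4)) M]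
  [IsManifold (𝓡 4) ∞ M]

namespace SpinDyad

variable {g : LorentzMetric M} (d : SpinDyad g) {nab : AffineConnection M}

theorem spinConn_mem (hLC : IsLeviCivita g nab) (A A' B C : Fin 2) :
    d.spinConn nab A A' B C ∈ smoothRing M := by
  have h : d.spinConn nab A A' B C = (fun _ ↦ 1 / 2 : M → ℂ) *
      ∑ B' : Fin 2, ∑ D : Fin 2, ∑ D' : Fin 2,
        (fun _ ↦ eps C D * eps B' D' : M → ℂ)
          * g.cval (ccov nab (d.tet A A') (d.tet B B')) (d.tet D D') := by
    ext x
    simp [spinConn]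
  rw [h]
  refine mul_mem (const_mem_smoothRing _) (sum_mem fun B' _ ↦ sum_mem fun D _ ↦ sum_mem fun D' _ ↦
    mul_mem (const_mem_smoothRing _) ?_)
  exact (hLC.smooth_ccov d (d.smooth_tet _ _) (d.smooth_tet _ _)).cval_mem (d.smooth_tet _ _)

theorem deriv_ccov_tet (hLC : IsLeviCivita g nab) (A A' B B' : Fin 2) (f : M → ℂ) (x : M) :
    (ccov nab (d.tet A A') (d.tet B B')).deriv f x =
      ∑ C, (d.spinConn nab A A' B C x * (d.tet C B').deriv f x
        + d.spinConnP nab A A' B' C x * (d.tet B C).deriv f x) := by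
  rw [d.deriv_expand]
  simp only [d.cval_ccov_tet hLC, Fin.sum_univ_two]
  fin_cases B <;> fin_cases B' <;> simp [eps] <;> ring

theorem deriv_bracket_eq (d : SpinDyad g) (hLC : IsLeviCivita g nab) {V W : CVectorField M}
    (hV : V.Smooth) (hW : W.Smooth) (f : M → ℂ) (x : M) : (V.bracket W).deriv f x =
      (ccov nab V W).deriv f x - (ccov nab W V).deriv f x := by
  rw [d.deriv_expand x (V.bracket W), d.deriv_expand x (ccov nab V W),
    d.deriv_expand x (ccov nab W V)]
  simp only [hLC.cval_bracket hV hW, ← Finset.sum_sub_distrib]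
  simp only [mul_sub, sub_mul]

/-- The spin frame of a dyad. -/
def frame (hLC : IsLeviCivita g nab) : SpinFrame (smoothRing M) where
  D A A' := (d.tet A A').derivation (d.smooth_tet A A')
  γ A A' B C := ⟨d.spinConn nab A A' B C, d.spinConn_mem hLC A A' B C⟩
  γP A A' B C := ⟨d.spinConnP nab A A' B C, conj_mem_smoothRing (d.spinConn_mem hLC A' A B C)⟩
  γ_traceless A A' := by
    ext x
    exact d.spinConn_traceless hLC A A' x
  γP_traceless A A' := by
    ext x
    change d.spinConnP nab A A' 1 1 x = -d.spinConnP nab A A' 0 0 x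
    rw [spinConnP, spinConnP, d.spinConn_traceless hLC, map_neg]
  comm A A' B B' f := by
    ext x
    have h := d.deriv_bracket (d.smooth_tet A A') (d.smooth_tet B B') f.2 x
    rw [d.deriv_bracket_eq hLC (d.smooth_tet A A') (d.smooth_tet B B'), d.deriv_ccov_tet hLC,
      d.deriv_ccov_tet hLC] at h
    simp only [Fin.sum_univ_two] at h ⊢
    exact h.symm

theorem frame_D (hLC : IsLeviCivita g nab) (A A' : Fin 2) (f : smoothRing M) (x : M) :
    ((d.frame hLC).D A A' f : M → ℂ) x = (d.tet A A').deriv f x := rfl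

/-- `ε_{AB}` as a constant function. -/
def epsC (M : Type*) [TopologicalSpace M] [ChartedSpace (EuclideanSpace ℝ (Fin 4)) M]
    (A B : Fin 2) : smoothRing M := ⟨fun _ ↦ eps A B, const_mem_smoothRing _⟩

/-- `g(∇_{AA'} e_{BB'}, e_{DD'})` in terms of the spin connection. -/
def lowConn (S : SpinFrame (smoothRing M)) (A A' B B' D D' : Fin 2) : smoothRing M :=
  (∑ C, S.γ A A' B C * epsC M C D) * epsC M B' D'
    + (∑ C, S.γP A A' B' C * epsC M C D') * epsC M B D

theorem coe_lowConn (hLC : IsLeviCivita g nab) (A A' B B' D D' : Fin 2) :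
    g.cval (ccov nab (d.tet A A') (d.tet B B')) (d.tet D D')
      = (lowConn (d.frame hLC) A A' B B' D D' : M → ℂ) := by
  ext x
  rw [d.cval_ccov_tet hLC]
  simp only [lowConn, Fin.sum_univ_two]
  rfl

theorem deriv_lowConn (hLC : IsLeviCivita g nab) (A A' B B' C C' E E' : Fin 2) (x : M) :
    (d.tet A A').deriv (g.cval (ccov nab (d.tet B B') (d.tet C C')) (d.tet E E')) x =
      (∑ F, (d.tet A A').deriv (d.spinConn nab B B' C F) x * eps F E) * eps C' E'
        + (∑ F, (d.tet A A').deriv (d.spinConnP nab B B' C' F) x * eps F E') * eps C E := by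
  have hD : ∀ F E, (d.frame hLC).D A A' (epsC M F E) = 0 := by
    intro F E
    ext x
    exact CVectorField.deriv_const _ _ x
  rw [d.coe_lowConn hLC, ← d.frame_D hLC]
  simp only [lowConn, Fin.sum_univ_two, map_add, Derivation.leibniz, hD, smul_eq_mul,
    mul_zero, zero_add]
  change eps C' E' * (eps 0 E * (d.tet A A').deriv (d.spinConn nab B B' C 0) x
    + eps 1 E * (d.tet A A').deriv (d.spinConn nab B B' C 1) x)
    + eps C E * (eps 0 E' * (d.tet A A').deriv (d.spinConnP nab B B' C' 0) x
    + eps 1 E' * (d.tet A A').deriv (d.spinConnP nab B B' C' 1) x) = _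
  ring

theorem coe_curv_γ (hLC : IsLeviCivita g nab) (A A' B B' C E : Fin 2) (x : M) :
    ((d.frame hLC).curv (d.frame hLC).γ A A' B B' C E : M → ℂ) x =
      (d.tet A A').deriv (d.spinConn nab B B' C E) x
        - (d.tet B B').deriv (d.spinConn nab A A' C E) x
        + ∑ F, (d.spinConn nab B B' C F x * d.spinConn nab A A' F E x
          - d.spinConn nab A A' C F x * d.spinConn nab B B' F E x)
        - (∑ F, (d.spinConn nab A A' B F x * d.spinConn nab F B' C E x
            + d.spinConnP nab A A' B' F x * d.spinConn nab B F C E x)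
          - ∑ F, (d.spinConn nab B B' A F x * d.spinConn nab F A' C E x
            + d.spinConnP nab B B' A' F x * d.spinConn nab A F C E x)) := by
  simp only [SpinFrame.curv, Fin.sum_univ_two]
  rfl

theorem coe_curv_γP (hLC : IsLeviCivita g nab) (A A' B B' C E : Fin 2) (x : M) :
    ((d.frame hLC).curv (d.frame hLC).γP A A' B B' C E : M → ℂ) x =
      (d.tet A A').deriv (d.spinConnP nab B B' C E) x
        - (d.tet B B').deriv (d.spinConnP nab A A' C E) x
        + ∑ F, (d.spinConnP nab B B' C F x * d.spinConnP nab A A' F E x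
          - d.spinConnP nab A A' C F x * d.spinConnP nab B B' F E x)
        - (∑ F, (d.spinConn nab A A' B F x * d.spinConnP nab F B' C E x
            + d.spinConnP nab A A' B' F x * d.spinConnP nab B F C E x)
          - ∑ F, (d.spinConn nab B B' A F x * d.spinConnP nab F A' C E x
            + d.spinConnP nab B B' A' F x * d.spinConnP nab A F C E x)) := by
  simp only [SpinFrame.curv, Fin.sum_univ_two]
  rfl

theorem cval_ccov_ccov (hLC : IsLeviCivita g nab) (A A' B B' C C' E E' : Fin 2) (x : M) :
    g.cval (ccov nab (d.tet B B') (d.tet C C')) (ccov nab (d.tet A A') (d.tet E E')) x =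
      -(∑ F, ∑ G, d.spinConn nab B B' C F x * d.spinConn nab A A' F G x * eps G E) * eps C' E'
      - (∑ F, ∑ G, d.spinConnP nab B B' C' F x * d.spinConnP nab A A' F G x * eps G E') * eps C E
      - (∑ F, d.spinConn nab B B' C F x * eps F E) * (∑ F, d.spinConnP nab A A' C' F x * eps F E')
      - (∑ F, d.spinConnP nab B B' C' F x * eps F E')
        * (∑ F, d.spinConn nab A A' C F x * eps F E) := by
  rw [d.cval_expand]
  simp only [cval_symm (d.tet _ _) (ccov nab (d.tet A A') (d.tet E E')), d.cval_ccov_tet hLC,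
    Fin.sum_univ_two]
  fin_cases C <;> fin_cases C' <;> fin_cases E <;> fin_cases E' <;>
    simp [eps, d.spinConn_traceless hLC, d.spinConnP_traceless hLC] <;> ring

theorem cval_ccov_bracket (hLC : IsLeviCivita g nab) (A A' B B' : Fin 2) (Z U : CVectorField M)
    (x : M) :
    g.cval (ccov nab ((d.tet A A').bracket (d.tet B B')) Z) U x =
      ∑ C, (d.spinConn nab A A' B C x * g.cval (ccov nab (d.tet C B') Z) U x
        + d.spinConnP nab A A' B' C x * g.cval (ccov nab (d.tet B C) Z) U x)
      - ∑ C, (d.spinConn nab B B' A C x * g.cval (ccov nab (d.tet C A') Z) U x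
        + d.spinConnP nab B B' A' C x * g.cval (ccov nab (d.tet A C) Z) U x) := by
  have key : ∀ A A' B B' (h : Fin 2 → Fin 2 → ℂ), ∑ C, ∑ C', ∑ D, ∑ D',
      eps C D * eps C' D' * g.cval (ccov nab (d.tet A A') (d.tet B B')) (d.tet D D') x * h C C'
      = ∑ C, (d.spinConn nab A A' B C x * h C B' + d.spinConnP nab A A' B' C x * h B C) := by
    intro A A' B B' h
    simp only [d.cval_ccov_tet hLC, Fin.sum_univ_two]
    fin_cases B <;> fin_cases B' <;> simp [eps] <;> ring
  rw [d.ccov_expand x ((d.tet A A').bracket (d.tet B B')), ← key A A' B B'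
    (fun C C' ↦ g.cval (ccov nab (d.tet C C') Z) U x), ← key B B' A A'
    (fun C C' ↦ g.cval (ccov nab (d.tet C C') Z) U x)]
  simp only [hLC.cval_bracket (d.smooth_tet A A') (d.smooth_tet B B'), ← Finset.sum_sub_distrib]
  simp only [mul_sub, sub_mul]

/-- The Riemann tensor in terms of the curvatures of the two spin connections. -/
theorem riemann_tet (hLC : IsLeviCivita g nab) (A A' B B' C C' E E' : Fin 2) (x : M) :
    riemann g nab (d.tet A A') (d.tet B B') (d.tet C C') (d.tet E E') x =
      (∑ F, ((d.frame hLC).curv (d.frame hLC).γ A A' B B' C F : M → ℂ) x * eps F E) * eps C' E'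
      + (∑ F, ((d.frame hLC).curv (d.frame hLC).γP A A' B B' C' F : M → ℂ) x * eps F E')
        * eps C E := by
  have sm := fun A A' B B' ↦ hLC.smooth_ccov d (d.smooth_tet A A') (d.smooth_tet B B')
  have h1 := hLC.deriv_cval (d.tet A A') (sm B B' C C') (d.smooth_tet E E') x
  have h2 := hLC.deriv_cval (d.tet B B') (sm A A' C C') (d.smooth_tet E E') x
  rw [d.deriv_lowConn hLC, d.cval_ccov_ccov hLC] at h1 h2
  rw [riemann, d.cval_ccov_bracket hLC, eq_sub_of_add_eq h1.symm, eq_sub_of_add_eq h2.symm]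
  simp only [coe_curv_γ, coe_curv_γP, d.cval_ccov_tet hLC, Fin.sum_univ_two]
  ring

end SpinDyad

end

section

/-! ### The curvature spinors of an Einstein background -/

theorem SpinFrame.curv_traceless {K : Type*} [CommRing K] (S : SpinFrame K)
    (N : Fin 2 → Fin 2 → Fin 2 → Fin 2 → K) (hN : ∀ A A', N A A' 1 1 = -N A A' 0 0)
    (A A' B B' : Fin 2) : S.curv N A A' B B' 1 1 = -S.curv N A A' B B' 0 0 := by
  simp only [curv, Fin.sum_univ_two, hN, map_neg]
  ring

/-- The linear relations which the Einstein equations impose on the components of the Riemann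
tensor in a null tetrad `(l, n, m, m̄)`, numbered `0, 1, 2, 3`. -/
def EinsteinRelations (R : Fin 4 → Fin 4 → Fin 4 → Fin 4 → ℂ) (Λ : ℂ) : Prop :=
    (R 0 2 0 1 + R 0 2 2 3 = 0 ∧ R 0 2 0 3 = 0 ∧ R 0 2 2 1 = 0) ∧
    (R 3 1 0 1 + R 3 1 2 3 = 0 ∧ R 3 1 0 3 = 0 ∧ R 3 1 2 1 = 0) ∧
    (R 0 1 0 1 + R 0 1 2 3 = R 2 3 0 1 + R 2 3 2 3 ∧ R 0 1 0 3 = R 2 3 0 3 ∧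
      R 0 1 2 1 = R 2 3 2 1) ∧
    R 0 1 0 1 - R 0 1 2 3 - R 2 3 0 1 + R 2 3 2 3 = 4 * R 0 2 3 1 - 12 * Λ ∧
    R 3 1 0 1 - R 3 1 2 3 = R 0 1 3 1 - R 2 3 3 1

/-- Consequences of the Einstein equations for the components of the Riemann tensor in a null
tetrad `(l, n, m, m̄)`, numbered `0, 1, 2, 3`. -/
theorem einstein_components (R : Fin 4 → Fin 4 → Fin 4 → Fin 4 → ℂ) (Λ : ℂ)
    (ha : ∀ a b c e, R b a c e = -R a b c e) (hb : ∀ a b c e, R a b e c = -R a b c e)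
    (hp : ∀ a b c e, R a b c e = R c e a b)
    (hc : ∀ a b c e, R a b c e + R b c a e + R c a b e = 0)
    (hR : ∀ b e, R 0 b 1 e + R 1 b 0 e - R 2 b 3 e - R 3 b 2 e =
      6 * Λ * !![0, 1, 0, 0; 1, 0, 0, 0; 0, 0, 0, -1; 0, 0, -1, 0] b e) :
    EinsteinRelations R Λ := by
  have z1 : ∀ a c e, R a a c e = 0 := fun a c e ↦ by linear_combination (1 / 2) * ha a a c e
  have z2 : ∀ a b c, R a b c c = 0 := fun a b c ↦ by linear_combination (1 / 2) * hb a b c c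
  have h00 := hR 0 0
  have h02 := hR 0 2
  have h03 := hR 0 3
  have h01 := hR 0 1
  have h11 := hR 1 1
  have h12 := hR 1 2
  have h13 := hR 1 3
  have h22 := hR 2 2
  have h23 := hR 2 3
  have h33 := hR 3 3
  have hcyc := hc 0 1 2 3
  simp [z1, z2, ha 0 1, ha 0 2, ha 0 3, ha 1 2, ha 1 3, ha 2 3, hb _ _ 0 2, hb _ _ 0 3,
    hb _ _ 1 2, hb _ _ 1 3, hb _ _ 2 3, hp 0 3 0 2, hp 1 2 0 3, hp 1 3 0 3, hp 1 3 1 2, hp 1 2 0 2]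
    at h00 h02 h03 h01 h11 h12 h13 h22 h23 h33 hcyc
  refine ⟨⟨?_, ?_, ?_⟩, ⟨?_, ?_, ?_⟩, ⟨?_, ?_, ?_⟩, ?_, ?_⟩ <;> grind

variable {M : Type*} [TopologicalSpace M] [ChartedSpace (EuclideanSpace ℝ (Fin 4)) M]
  [IsManifold (𝓡 4) ∞ M]

namespace SpinDyad

variable {g : LorentzMetric M} (d : SpinDyad g) {nab : AffineConnection M}

/-- The tetrad `(l, n, m, m̄)`. -/
def tetrad (i : Fin 4) : CVectorField M := ![d.tet 0 0, d.tet 1 1, d.tet 0 1, d.tet 1 0] i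

theorem smooth_tetrad (i : Fin 4) : (d.tetrad i).Smooth := by
  fin_cases i
  · exact d.smooth_tet 0 0
  · exact d.smooth_tet 1 1
  · exact d.smooth_tet 0 1
  · exact d.smooth_tet 1 0

theorem ricci_tet {Λ : ℝ} (hE : d.IsEinstein nab Λ) (A A' B B' : Fin 2) (x : M) :
    d.ricci nab (d.tet A A') (d.tet B B') x = 6 * Λ * (eps A B * eps A' B') := by
  have h1 := hE.1 A B A' B' x
  have h2 := hE.2 x
  rw [Phi, d.cval_tet] at h1
  linear_combination (-2) * h1 + 6 * (eps A B * eps A' B') * h2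

theorem ricci_tetrad {Λ : ℝ} (hE : d.IsEinstein nab Λ) (i j : Fin 4) (x : M) :
    d.ricci nab (d.tetrad i) (d.tetrad j) x =
      6 * Λ * !![0, 1, 0, 0; 1, 0, 0, 0; 0, 0, 0, -1; 0, 0, -1, 0] i j := by
  fin_cases i <;> fin_cases j <;>
    simp [tetrad, d.ricci_tet hE, eps]

theorem riemann_components (hLC : IsLeviCivita g nab) {Λ : ℝ} (hE : d.IsEinstein nab Λ) (x : M) :
    EinsteinRelations
      (fun i j k l ↦ riemann g nab (d.tetrad i) (d.tetrad j) (d.tetrad k) (d.tetrad l) x) Λ :=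
  einstein_components _ _
    (fun _ _ _ _ ↦ riemann_swap_left _ _ _ _ x)
    (fun _ _ _ _ ↦ hLC.riemann_swap_right d (d.smooth_tetrad _) (d.smooth_tetrad _)
      (d.smooth_tetrad _) (d.smooth_tetrad _) x)
    (fun _ _ _ _ ↦ hLC.riemann_pair d (d.smooth_tetrad _) (d.smooth_tetrad _)
      (d.smooth_tetrad _) (d.smooth_tetrad _) x)
    (fun _ _ _ _ ↦ hLC.riemann_cyclic d (d.smooth_tetrad _) (d.smooth_tetrad _)
      (d.smooth_tetrad _) _ x)
    (fun i j ↦ d.ricci_tetrad hE i j x)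

/-- A smooth constant function. -/
def constC (M : Type*) [TopologicalSpace M] [ChartedSpace (EuclideanSpace ℝ (Fin 4)) M]
    (c : ℂ) : smoothRing M := ⟨fun _ ↦ c, const_mem_smoothRing c⟩

theorem riemann_lmln {Λ : ℝ} (hE : d.IsEinstein nab Λ) (hII : d.IsTypeII nab) (x : M) :
    riemann g nab (d.tet 0 0) (d.tet 0 1) (d.tet 0 0) (d.tet 1 1) x = 0 := by
  have h := (hII x).2.1
  have h1 : d.weyl nab (d.tet 0 0) (d.tet 0 1) (d.tet 0 0) (d.tet 1 1) x = 0 := h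
  rw [weyl, d.cval_tet, d.cval_tet, d.cval_tet, d.cval_tet, d.ricci_tet hE, d.ricci_tet hE,
    d.ricci_tet hE, d.ricci_tet hE] at h1
  simpa [eps] using h1

theorem coe_curv_traceless (hLC : IsLeviCivita g nab) (A A' B B' : Fin 2) (x : M) :
    ((d.frame hLC).curv (d.frame hLC).γ A A' B B' 1 1 : M → ℂ) x =
      -((d.frame hLC).curv (d.frame hLC).γ A A' B B' 0 0 : M → ℂ) x := by
  rw [(d.frame hLC).curv_traceless _ (d.frame hLC).γ_traceless]
  rfl

theorem coe_curvP_traceless (hLC : IsLeviCivita g nab) (A A' B B' : Fin 2) (x : M) :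
    ((d.frame hLC).curv (d.frame hLC).γP A A' B B' 1 1 : M → ℂ) x =
      -((d.frame hLC).curv (d.frame hLC).γP A A' B B' 0 0 : M → ℂ) x := by
  rw [(d.frame hLC).curv_traceless _ (d.frame hLC).γP_traceless]
  rfl

/-- The curvature of `S'` has no anti-self-dual part. -/
theorem curvP_eq_zero (hLC : IsLeviCivita g nab) {Λ : ℝ} (hE : d.IsEinstein nab Λ)
    (C E : Fin 2) :
    (d.frame hLC).curv (d.frame hLC).γP 0 0 0 1 C E = 0 ∧
    (d.frame hLC).curv (d.frame hLC).γP 0 0 1 1 C E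
      = (d.frame hLC).curv (d.frame hLC).γP 0 1 1 0 C E ∧
    (d.frame hLC).curv (d.frame hLC).γP 1 0 1 1 C E = 0 := by
  have ev : ∀ a b : smoothRing M, (∀ x, (a : M → ℂ) x = (b : M → ℂ) x) → a = b :=
    fun a b h ↦ Subtype.ext (funext h)
  refine ⟨ev _ _ fun x ↦ ?_, ev _ _ fun x ↦ ?_, ev _ _ fun x ↦ ?_⟩ <;>
  · obtain ⟨⟨h1, h2, h3⟩, ⟨h4, h5, h6⟩, ⟨h7, h8, h9⟩, -, -⟩ := d.riemann_components hLC hE x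
    simp [tetrad, d.riemann_tet hLC, eps, d.coe_curvP_traceless hLC] at h1 h2 h3 h4 h5 h6 h7 h8 h9
    fin_cases C <;> fin_cases E <;> simp [d.coe_curvP_traceless hLC] <;> grind

theorem curv_relations (hLC : IsLeviCivita g nab) {Λ : ℝ} (hE : d.IsEinstein nab Λ)
    (hII : d.IsTypeII nab) :
    (d.frame hLC).curv (d.frame hLC).γ 0 0 0 1 0 0 = 0 ∧
    (d.frame hLC).curv (d.frame hLC).γ 0 0 1 1 0 0 - (d.frame hLC).curv (d.frame hLC).γ 0 1 1 0 0 0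
      = 2 * (d.frame hLC).curv (d.frame hLC).γ 0 0 0 1 1 0 - 6 * constC M Λ ∧
    2 * (d.frame hLC).curv (d.frame hLC).γ 1 0 1 1 0 0 =
      (d.frame hLC).curv (d.frame hLC).γ 0 0 1 1 1 0
        - (d.frame hLC).curv (d.frame hLC).γ 0 1 1 0 1 0 := by
  have ev : ∀ a b : smoothRing M, (∀ x, (a : M → ℂ) x = (b : M → ℂ) x) → a = b :=
    fun a b h ↦ Subtype.ext (funext h)
  have c : ∀ x, ((constC M Λ : smoothRing M) : M → ℂ) x = Λ := fun x ↦ rfl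
  have c2 : ∀ x, ((2 : smoothRing M) : M → ℂ) x = 2 := fun x ↦ rfl
  have c6 : ∀ x, ((6 : smoothRing M) : M → ℂ) x = 6 := fun x ↦ rfl
  refine ⟨ev _ _ fun x ↦ ?_, ev _ _ fun x ↦ ?_, ev _ _ fun x ↦ ?_⟩ <;>
  · obtain ⟨⟨h1, h2, h3⟩, -, -, h4, h5⟩ := d.riemann_components hLC hE x
    have h6 := d.riemann_lmln hE hII x
    simp [tetrad, d.riemann_tet hLC, eps, d.coe_curv_traceless hLC,
      d.coe_curvP_traceless hLC] at h1 h2 h3 h4 h5 h6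
    simp [c, c2, c6]
    grind

end SpinDyad

end

section

/-! ### Spinor calculus in a spin frame -/

/-- The action of one matrix for each index on a field of components. -/
def act {K : Type*} [CommRing K] {r : ℕ} (Φ : (Fin r → Fin 2) → K) (I : Fin r → Fin 2) :
    (Fin r → Fin 2 → Fin 2 → K) →ₗ[K] K where
  toFun X := ∑ j, ∑ c, X j (I j) c * Φ (Function.update I j c)
  map_add' X Y := by simp only [Pi.add_apply, add_mul, Finset.sum_add_distrib]
  map_smul' a X := by
    simp only [Pi.smul_apply, smul_eq_mul, mul_assoc, Finset.mul_sum, RingHom.id_apply]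

section Act

variable {K : Type*} [CommRing K] {r : ℕ}

theorem act_apply (Φ : (Fin r → Fin 2) → K) (I : Fin r → Fin 2) (X : Fin r → Fin 2 → Fin 2 → K) :
    act Φ I X = ∑ j, ∑ c, X j (I j) c * Φ (Function.update I j c) := rfl

theorem act_add_field (Φ Ψ : (Fin r → Fin 2) → K) (I : Fin r → Fin 2)
    (X : Fin r → Fin 2 → Fin 2 → K) : act (Φ + Ψ) I X = act Φ I X + act Ψ I X := by
  simp only [act_apply, Pi.add_apply, mul_add, Finset.sum_add_distrib]

theorem act_smul_field (a : K) (Φ : (Fin r → Fin 2) → K) (I : Fin r → Fin 2)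
    (X : Fin r → Fin 2 → Fin 2 → K) : act (a • Φ) I X = a * act Φ I X := by
  simp only [act_apply, Pi.smul_apply, smul_eq_mul, Finset.mul_sum]
  exact Finset.sum_congr rfl fun j _ ↦ Finset.sum_congr rfl fun c _ ↦ by ring

/-- The commutator of two index actions is the action of the commutators. -/
theorem act_comm (Φ : (Fin r → Fin 2) → K) (I : Fin r → Fin 2)
    (X Y : Fin r → Fin 2 → Fin 2 → K) :
    act (fun J ↦ act Φ J Y) I X - act (fun J ↦ act Φ J X) I Y =
      act Φ I (fun j b c ↦ ∑ f, (X j b f * Y j f c - Y j b f * X j f c)) := by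
  have expand : ∀ X Y : Fin r → Fin 2 → Fin 2 → K, act (fun J ↦ act Φ J Y) I X =
      ∑ j, ∑ i, ∑ c, ∑ e, X j (I j) c * (Y i (Function.update I j c i) e *
        Φ (Function.update (Function.update I j c) i e)) := by
    intro X Y
    simp only [act_apply, Finset.mul_sum]
    exact Finset.sum_congr rfl fun j _ ↦ Finset.sum_comm
  rw [expand X Y, expand Y X, act_apply]
  conv_lhs =>
    rw [Finset.sum_comm (s := Finset.univ) (t := Finset.univ)
      (f := fun j i ↦ ∑ c, ∑ e, Y j (I j) c * (X i (Function.update I j c i) e *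
        Φ (Function.update (Function.update I j c) i e)))]
  rw [← Finset.sum_sub_distrib]
  refine Finset.sum_congr rfl fun j _ ↦ ?_
  rw [← Finset.sum_sub_distrib, Finset.sum_eq_single j]
  · simp only [Function.update_self, Function.update_idem, Fin.sum_univ_two]
    ring
  · intro i _ hij
    rw [sub_eq_zero, Finset.sum_comm]
    refine Finset.sum_congr rfl fun c _ ↦ Finset.sum_congr rfl fun e _ ↦ ?_
    rw [Function.update_of_ne hij, Function.update_of_ne hij.symm,
      Function.update_comm hij.symm]
    ring
  · simp

end Act

namespace SpinFrame

variable {K : Type*} [CommRing K] (S : SpinFrame K) {r : ℕ}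

/-- The connection matrix on an index of the given type. -/
def idx (s : IndexType) (A A' b c : Fin 2) : K :=
  match s.primed, s.upper with
  | false, true => S.γ A A' c b
  | false, false => -S.γ A A' b c
  | true, true => S.γP A A' c b
  | true, false => -S.γP A A' b c

/-- The covariant derivative `∇_{AA'} Φ`. -/
def cov (k : Fin r → IndexType) (A A' : Fin 2) (Φ : (Fin r → Fin 2) → K) (I : Fin r → Fin 2) : K :=
  S.D A A' (Φ I) + act Φ I (fun j ↦ S.idx (k j) A A')

/-- The curvature matrix on an index of the given type. -/
def idxCurv (s : IndexType) (A A' B B' b c : Fin 2) : K :=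
  match s.primed, s.upper with
  | false, true => S.curv S.γ A A' B B' c b
  | false, false => -S.curv S.γ A A' B B' b c
  | true, true => S.curv S.γP A A' B B' c b
  | true, false => -S.curv S.γP A A' B B' b c

theorem idxCurv_eq (s : IndexType) (A A' B B' b c : Fin 2) : S.idxCurv s A A' B B' b c =
    S.D A A' (S.idx s B B' b c) - S.D B B' (S.idx s A A' b c)
      + ∑ f, (S.idx s A A' b f * S.idx s B B' f c - S.idx s B B' b f * S.idx s A A' f c)
      - (∑ F, (S.γ A A' B F * S.idx s F B' b c + S.γP A A' B' F * S.idx s B F b c)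
        - ∑ F, (S.γ B B' A F * S.idx s F A' b c + S.γP B B' A' F * S.idx s A F b c)) := by
  obtain ⟨p, u⟩ := s
  cases p <;> cases u <;> simp only [idxCurv, idx, curv, Fin.sum_univ_two, map_neg] <;> ring

theorem D_act (A A' : Fin 2) (Φ : (Fin r → Fin 2) → K) (I : Fin r → Fin 2)
    (X : Fin r → Fin 2 → Fin 2 → K) : S.D A A' (act Φ I X) =
      act Φ I (fun j b c ↦ S.D A A' (X j b c)) + act (fun J ↦ S.D A A' (Φ J)) I X := by
  simp only [act_apply, map_sum, Derivation.leibniz, smul_eq_mul, ← Finset.sum_add_distrib]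
  exact Finset.sum_congr rfl fun j _ ↦ Finset.sum_congr rfl fun c _ ↦ by ring

theorem cov_add (k : Fin r → IndexType) (A A' : Fin 2) (Φ Ψ : (Fin r → Fin 2) → K)
    (I : Fin r → Fin 2) : S.cov k A A' (Φ + Ψ) I = S.cov k A A' Φ I + S.cov k A A' Ψ I := by
  simp only [cov, act_add_field, Pi.add_apply, map_add]
  ring

theorem cov_smul (k : Fin r → IndexType) (A A' : Fin 2) (a : K) (Φ : (Fin r → Fin 2) → K)
    (I : Fin r → Fin 2) :
    S.cov k A A' (a • Φ) I = S.D A A' a * Φ I + a * S.cov k A A' Φ I := by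
  simp only [cov, act_smul_field, Pi.smul_apply, smul_eq_mul, Derivation.leibniz]
  ring

/-- The commutator of covariant derivatives. -/
theorem cov_comm (k : Fin r → IndexType) (A A' B B' : Fin 2) (Φ : (Fin r → Fin 2) → K)
    (I : Fin r → Fin 2) :
    S.cov k A A' (S.cov k B B' Φ) I - S.cov k B B' (S.cov k A A' Φ) I =
      ∑ C, (S.γ A A' B C * S.cov k C B' Φ I + S.γP A A' B' C * S.cov k B C Φ I)
      - ∑ C, (S.γ B B' A C * S.cov k C A' Φ I + S.γP B B' A' C * S.cov k A C Φ I)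
      + act Φ I (fun j ↦ S.idxCurv (k j) A A' B B') := by
  have hR : (fun j ↦ S.idxCurv (k j) A A' B B') =
      (fun j b c ↦ S.D A A' (S.idx (k j) B B' b c)) - (fun j b c ↦ S.D B B' (S.idx (k j) A A' b c))
      + (fun j b c ↦ ∑ f, (S.idx (k j) A A' b f * S.idx (k j) B B' f c
        - S.idx (k j) B B' b f * S.idx (k j) A A' f c))
      - (∑ F, (S.γ A A' B F • (fun j ↦ S.idx (k j) F B')
          + S.γP A A' B' F • (fun j ↦ S.idx (k j) B F))
        - ∑ F, (S.γ B B' A F • (fun j ↦ S.idx (k j) F A')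
          + S.γP B B' A' F • (fun j ↦ S.idx (k j) A F))) := by
    ext j b c
    rw [idxCurv_eq]
    simp only [Fin.sum_univ_two, Pi.add_apply, Pi.sub_apply, Pi.smul_apply, smul_eq_mul]
  have e : ∀ A A' B B', S.cov k A A' (S.cov k B B' Φ) I = S.D A A' (S.D B B' (Φ I))
      + act Φ I (fun j b c ↦ S.D A A' (S.idx (k j) B B' b c))
      + act (fun J ↦ S.D A A' (Φ J)) I (fun j ↦ S.idx (k j) B B')
      + act (fun J ↦ S.D B B' (Φ J)) I (fun j ↦ S.idx (k j) A A')
      + act (fun J ↦ act Φ J (fun j ↦ S.idx (k j) B B')) I (fun j ↦ S.idx (k j) A A') := by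
    intro A A' B B'
    have h : S.cov k B B' Φ = (fun J ↦ S.D B B' (Φ J))
        + (fun J ↦ act Φ J (fun j ↦ S.idx (k j) B B')) := rfl
    rw [h, cov_add, cov, cov, D_act]
    ring
  have h1 := S.comm A A' B B' (Φ I)
  have h2 := act_comm Φ I (fun j ↦ S.idx (k j) A A') (fun j ↦ S.idx (k j) B B')
  rw [hR, e, e]
  simp only [map_add, map_sub, map_smul, smul_eq_mul, Fin.sum_univ_two, cov] at h1 h2 ⊢
  linear_combination h1 + h2

/-- Vanishing of the anti-self-dual part of the curvature of `S'`. -/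
structure PrimedFlat : Prop where
  zero_zero : ∀ C E, S.curv S.γP 0 0 0 1 C E = 0
  zero_one : ∀ C E, S.curv S.γP 0 0 1 1 C E = S.curv S.γP 0 1 1 0 C E
  one_one : ∀ C E, S.curv S.γP 1 0 1 1 C E = 0

variable {S}

theorem PrimedFlat.act_zero (h : S.PrimedFlat) {k : Fin r → IndexType}
    (hk : ∀ j, (k j).primed = true) (Φ : (Fin r → Fin 2) → K) (I : Fin r → Fin 2) :
    act Φ I (fun j ↦ S.idxCurv (k j) 0 0 0 1) = 0 ∧
    act Φ I (fun j ↦ S.idxCurv (k j) 0 0 1 1) = act Φ I (fun j ↦ S.idxCurv (k j) 0 1 1 0) ∧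
    act Φ I (fun j ↦ S.idxCurv (k j) 1 0 1 1) = 0 := by
  have hz : ∀ A A' B B', (∀ C E, S.curv S.γP A A' B B' C E = 0) →
      (fun j ↦ S.idxCurv (k j) A A' B B') = 0 := by
    intro A A' B B' h0
    ext j b c
    cases hu : (k j).upper <;> simp [idxCurv, hk, hu, h0]
  have he : (fun j ↦ S.idxCurv (k j) 0 0 1 1) = (fun j ↦ S.idxCurv (k j) 0 1 1 0) := by
    ext j b c
    cases hu : (k j).upper <;> simp [idxCurv, hk, hu, h.zero_one]
  rw [hz _ _ _ _ h.zero_zero, hz _ _ _ _ h.one_one, he]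
  simp

variable (S)

theorem cov_cons (s : IndexType) (k : Fin r → IndexType) (A A' : Fin 2)
    (Ψ : (Fin (r + 1) → Fin 2) → K) (b : Fin 2) (I : Fin r → Fin 2) :
    S.cov (Fin.cons s k : Fin (r + 1) → IndexType) A A' Ψ (Fin.cons b I) =
      S.cov k A A' (fun J ↦ Ψ (Fin.cons b J)) I + ∑ c, S.idx s A A' b c * Ψ (Fin.cons c I) := by
  simp only [cov, act_apply, Fin.sum_univ_succ (n := r), Fin.cons_zero, Fin.cons_succ,
    Fin.update_cons_zero, ← Fin.cons_update]
  ring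

/-- The GHP derivative `Θ_{AA'} Φ` of a field of weight `{p,0}`. -/
def theta (p : ℤ) (k : Fin r → IndexType) (A A' : Fin 2) (Φ : (Fin r → Fin 2) → K)
    (I : Fin r → Fin 2) : K :=
  S.cov k A A' Φ I - p * S.γ A A' 0 0 * Φ I

theorem cov_theta (p : ℤ) (k : Fin r → IndexType) (A A' B B' : Fin 2) (Φ : (Fin r → Fin 2) → K)
    (I : Fin r → Fin 2) : S.cov k A A' (S.theta p k B B' Φ) I =
      S.cov k A A' (S.cov k B B' Φ) I
        - p * (S.D A A' (S.γ B B' 0 0) * Φ I + S.γ B B' 0 0 * S.cov k A A' Φ I) := by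
  have h : S.theta p k B B' Φ = S.cov k B B' Φ + (-(p * S.γ B B' 0 0)) • Φ := by
    ext J
    simp [theta, sub_eq_add_neg]
  rw [h, cov_add, cov_smul]
  simp
  ring

/-- `Θ_{BA'} Φ` for fixed `B`, as a field with the additional index `A'`. -/
def thetaProj (p : ℤ) (k : Fin r → IndexType) (B : Fin 2) (Φ : (Fin r → Fin 2) → K)
    (J : Fin (r + 1) → Fin 2) : K :=
  S.theta p k B (J 0) Φ (Fin.tail J)

/-- `Θ_{AA'} Φ` as a field with two additional indices. -/
def thetaFull (p : ℤ) (k : Fin r → IndexType) (Φ : (Fin r → Fin 2) → K)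
    (J : Fin (r + 2) → Fin 2) : K :=
  S.theta p k (J 0) (J 1) Φ (fun j ↦ J j.succ.succ)

theorem theta_thetaProj (p q : ℤ) (k : Fin r → IndexType) (A A' B B' : Fin 2)
    (Φ : (Fin r → Fin 2) → K) (I : Fin r → Fin 2) :
    S.theta q (Fin.cons lowP k : Fin (r + 1) → IndexType) A A' (S.thetaProj p k B Φ)
      (Fin.cons B' I) =
      S.cov k A A' (S.cov k B B' Φ) I
        - p * (S.D A A' (S.γ B B' 0 0) * Φ I + S.γ B B' 0 0 * S.cov k A A' Φ I)
        - ∑ c, S.γP A A' B' c * (S.cov k B c Φ I - p * S.γ B c 0 0 * Φ I)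
        - q * S.γ A A' 0 0 * (S.cov k B B' Φ I - p * S.γ B B' 0 0 * Φ I) := by
  have h : ∀ c, S.thetaProj p k B Φ (Fin.cons c I : Fin (r + 1) → Fin 2) =
      S.cov k B c Φ I - p * S.γ B c 0 0 * Φ I := fun _ ↦ rfl
  rw [theta, cov_cons, show (fun J : Fin r → Fin 2 ↦ S.thetaProj p k B Φ
    (Fin.cons B' J : Fin (r + 1) → Fin 2)) = S.theta p k B B' Φ from rfl, cov_theta]
  simp only [h, idx, lowP, Fin.sum_univ_two]
  ring

theorem theta_thetaFull (p : ℤ) (k : Fin r → IndexType) (A A' B B' : Fin 2)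
    (Φ : (Fin r → Fin 2) → K) (I : Fin r → Fin 2) :
    S.theta p (Fin.cons low (Fin.cons lowP k) : Fin (r + 2) → IndexType) A A' (S.thetaFull p k Φ)
      (Fin.cons B (Fin.cons B' I)) =
      S.cov k A A' (S.cov k B B' Φ) I
        - p * (S.D A A' (S.γ B B' 0 0) * Φ I + S.γ B B' 0 0 * S.cov k A A' Φ I)
        - ∑ c, S.γP A A' B' c * (S.cov k B c Φ I - p * S.γ B c 0 0 * Φ I)
        - ∑ c, S.γ A A' B c * (S.cov k c B' Φ I - p * S.γ c B' 0 0 * Φ I)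
        - p * S.γ A A' 0 0 * (S.cov k B B' Φ I - p * S.γ B B' 0 0 * Φ I) := by
  have h : ∀ b c, S.thetaFull p k Φ (Fin.cons b (Fin.cons c I) : Fin (r + 2) → Fin 2) =
      S.cov k b c Φ I - p * S.γ b c 0 0 * Φ I := fun _ _ ↦ rfl
  rw [theta, cov_cons, cov_cons, show (fun J : Fin r → Fin 2 ↦ S.thetaFull p k Φ
    (Fin.cons B (Fin.cons B' J : Fin (r + 1) → Fin 2) : Fin (r + 2) → Fin 2)) =
      S.theta p k B B' Φ from rfl, cov_theta]
  simp only [h, idx, lowP, low, Fin.sum_univ_two]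
  ring

end SpinFrame

end

section

/-! ### The projected commutators in a spin frame -/

/-- The components of `ε_{AB}` in a commutative ring. -/
def ringEps (K : Type*) [CommRing K] (A B : Fin 2) : K := !![0, 1; -1, 0] A B

namespace SpinFrame

variable {K : Type*} [CommRing K] (S : SpinFrame K) {r : ℕ}

/-- The components of `f_{A'}`. -/
def fι (J : Fin 1 → Fin 2) : K := -S.γ 0 (J 0) 1 0

/-- The components of `f̃_{A'}`. -/
def fo (J : Fin 1 → Fin 2) : K := -S.γ 1 (J 0) 0 1

/-- The components of `σ'_{A'}`. -/
def sigι (J : Fin 1 → Fin 2) : K := S.γ 1 (J 0) 1 0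

/-- Algebraic form of the Einstein type II conditions with cosmological constant `L`. -/
structure TypeII (L : K) : Prop extends S.PrimedFlat where
  geodesic_shearfree : ∀ A', S.γ 0 A' 0 1 = 0
  curv_zero_zero : S.curv S.γ 0 0 0 1 0 0 = 0
  curv_zero_one : S.curv S.γ 0 0 1 1 0 0 - S.curv S.γ 0 1 1 0 0 0 =
    2 * S.curv S.γ 0 0 0 1 1 0 - 6 * L
  curv_one_one : 2 * S.curv S.γ 1 0 1 1 0 0 = S.curv S.γ 0 0 1 1 1 0 - S.curv S.γ 0 1 1 0 1 0

theorem thetaProj_one (q : ℤ) (A A' C : Fin 2) (Ψ : (Fin 1 → Fin 2) → K) :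
    S.thetaProj q ![lowP] A Ψ ![A', C] =
      S.D A A' (Ψ ![C]) - ∑ c, S.γP A A' C c * Ψ ![c] - q * S.γ A A' 0 0 * Ψ ![C] := by
  have e : (Fin.tail ![A', C] : Fin 1 → Fin 2) = ![C] := by ext j; fin_cases j; rfl
  have u : ∀ c, Function.update ![C] (0 : Fin 1) c = ![c] := fun c ↦ by ext j; fin_cases j; rfl
  simp [thetaProj, theta, cov, act_apply, e, u, idx, lowP]
  ring

variable {S} {L : K} {k : Fin r → IndexType}

/-- `[Θ̃_{A'}, Θ̃_{B'}] = 0`. -/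
theorem TypeII.tilde_tilde (h : S.TypeII L) (hk : ∀ j, (k j).primed = true) (p : ℤ)
    (Φ : (Fin r → Fin 2) → K) (I : Fin r → Fin 2) (A' B' : Fin 2) :
    S.thetaProj (p + 1) (Fin.cons lowP k) 0 (S.thetaProj p k 0 Φ) (Fin.cons A' (Fin.cons B' I))
      = S.thetaProj (p + 1) (Fin.cons lowP k) 0 (S.thetaProj p k 0 Φ)
        (Fin.cons B' (Fin.cons A' I)) := by
  have key : S.theta (p + 1) (Fin.cons lowP k : Fin (r + 1) → IndexType) 0 0
      (S.thetaProj p k 0 Φ) (Fin.cons 1 I) =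
      S.theta (p + 1) (Fin.cons lowP k : Fin (r + 1) → IndexType) 0 1
      (S.thetaProj p k 0 Φ) (Fin.cons 0 I) := by
    have hc := S.cov_comm k 0 0 0 1 Φ I
    have ht := h.curv_zero_zero
    rw [(h.act_zero hk Φ I).1] at hc
    rw [theta_thetaProj, theta_thetaProj]
    simp only [curv, Fin.sum_univ_two, h.geodesic_shearfree, S.γP_traceless] at hc ht ⊢
    push_cast
    linear_combination hc - p * Φ I * ht
  fin_cases A' <;> fin_cases B'
  · rfl
  · exact key
  · exact key.symm
  · rfl

/-- Twice the commutator `[Θ̃_{A'}, Θ_{B'}]`. -/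
theorem TypeII.tilde_iota (h : S.TypeII L) (hk : ∀ j, (k j).primed = true) (p : ℤ)
    (Φ : (Fin r → Fin 2) → K) (I : Fin r → Fin 2) (A' B' : Fin 2) :
    2 * (S.thetaProj (p - 1) (Fin.cons lowP k) 0 (S.thetaProj p k 1 Φ)
        (Fin.cons A' (Fin.cons B' I))
      - S.thetaProj (p + 1) (Fin.cons lowP k) 1 (S.thetaProj p k 0 Φ)
        (Fin.cons B' (Fin.cons A' I))) =
      ringEps K A' B' * p * (2 * (S.thetaProj (-1) ![lowP] 0 S.fι ![0, 1]
          - S.thetaProj (-1) ![lowP] 0 S.fι ![1, 0])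
        - (S.fo ![0] * S.fι ![1] - S.fo ![1] * S.fι ![0]) + 6 * L) * Φ I
      + ∑ A, ∑ B, ringEps K A B *
        (S.thetaFull p (Fin.cons low (Fin.cons lowP k)) (S.thetaFull p k Φ)
          (Fin.cons A (Fin.cons A' (Fin.cons B (Fin.cons B' I))))
        + S.thetaFull p (Fin.cons low (Fin.cons lowP k)) (S.thetaFull p k Φ)
          (Fin.cons A (Fin.cons B' (Fin.cons B (Fin.cons A' I)))))
      + 2 * (-S.fι ![A'] * S.thetaProj p k 0 Φ (Fin.cons B' I)
        + S.fo ![B'] * S.thetaProj p k 1 Φ (Fin.cons A' I)) := by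
  have hc := S.cov_comm k 0 0 1 1 Φ I
  have hd := S.cov_comm k 0 1 1 0 Φ I
  have ht := h.curv_zero_one
  have ha := (h.act_zero hk Φ I).2.1
  have eP : ∀ q (C B D E : Fin 2), S.thetaProj q (Fin.cons lowP k) C (S.thetaProj p k B Φ)
      (Fin.cons D (Fin.cons E I)) = S.theta q (Fin.cons lowP k : Fin (r + 1) → IndexType) C D
      (S.thetaProj p k B Φ) (Fin.cons E I) := fun _ _ _ _ _ ↦ rfl
  have eF : ∀ (A B C D : Fin 2),
      S.thetaFull p (Fin.cons low (Fin.cons lowP k)) (S.thetaFull p k Φ)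
          (Fin.cons A (Fin.cons B (Fin.cons C (Fin.cons D I)))) =
      S.theta p (Fin.cons low (Fin.cons lowP k) : Fin (r + 2) → IndexType) A B
      (S.thetaFull p k Φ) (Fin.cons C (Fin.cons D I)) := fun _ _ _ _ ↦ rfl
  have e1 : ∀ B C, S.thetaProj p k B Φ (Fin.cons C I : Fin (r + 1) → Fin 2) =
      S.cov k B C Φ I - p * S.γ B C 0 0 * Φ I := fun _ _ ↦ rfl
  simp only [eP, eF, theta_thetaProj, theta_thetaFull, thetaProj_one, e1]
  simp only [curv, Fin.sum_univ_two, h.geodesic_shearfree, S.γP_traceless, S.γ_traceless,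
    ringEps, fι, fo, Matrix.cons_val_zero, Matrix.of_apply, Matrix.cons_val_one, map_neg]
    at hc hd ht ⊢
  push_cast
  fin_cases A' <;> fin_cases B' <;> simp only [Fin.zero_eta, Fin.mk_one, Matrix.cons_val_zero,
    Matrix.cons_val_one, S.γP_traceless]
  · ring
  · linear_combination hc - hd + ha - p * Φ I * ht
  · linear_combination -hc + hd - ha + p * Φ I * ht
  · ring

/-- Twice the commutator `[Θ_{A'}, Θ_{B'}]`. -/
theorem TypeII.iota_iota (h : S.TypeII L) (hk : ∀ j, (k j).primed = true) (p : ℤ)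
    (Φ : (Fin r → Fin 2) → K) (I : Fin r → Fin 2) (A' B' : Fin 2) :
    2 * (S.thetaProj (p - 1) (Fin.cons lowP k) 1 (S.thetaProj p k 1 Φ)
        (Fin.cons A' (Fin.cons B' I))
      - S.thetaProj (p - 1) (Fin.cons lowP k) 1 (S.thetaProj p k 1 Φ)
        (Fin.cons B' (Fin.cons A' I))) =
      ringEps K A' B' * (p * ((S.thetaProj (-1) ![lowP] 1 S.fι ![0, 1]
          - S.thetaProj (-1) ![lowP] 1 S.fι ![1, 0])
        - (S.thetaProj (-3) ![lowP] 0 S.sigι ![0, 1] - S.thetaProj (-3) ![lowP] 0 S.sigι ![1, 0])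
        + (S.fo ![0] * S.sigι ![1] - S.fo ![1] * S.sigι ![0])) * Φ I
      - 2 * (S.thetaProj p k 0 Φ (Fin.cons 0 I) * S.sigι ![1]
        - S.thetaProj p k 0 Φ (Fin.cons 1 I) * S.sigι ![0])) := by
  have hc := S.cov_comm k 1 0 1 1 Φ I
  have ht := h.curv_one_one
  rw [(h.act_zero hk Φ I).2.2] at hc
  have eP : ∀ q (C B D E : Fin 2), S.thetaProj q (Fin.cons lowP k) C (S.thetaProj p k B Φ)
      (Fin.cons D (Fin.cons E I)) = S.theta q (Fin.cons lowP k : Fin (r + 1) → IndexType) C D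
      (S.thetaProj p k B Φ) (Fin.cons E I) := fun _ _ _ _ _ ↦ rfl
  have e1 : ∀ B C, S.thetaProj p k B Φ (Fin.cons C I : Fin (r + 1) → Fin 2) =
      S.cov k B C Φ I - p * S.γ B C 0 0 * Φ I := fun _ _ ↦ rfl
  simp only [eP, theta_thetaProj, thetaProj_one, e1]
  simp only [curv, Fin.sum_univ_two, S.γP_traceless, S.γ_traceless,
    ringEps, fι, fo, sigι, Matrix.cons_val_zero, Matrix.of_apply, map_neg]
    at hc ht ⊢
  push_cast
  fin_cases A' <;> fin_cases B' <;> simp only [Fin.zero_eta, Fin.mk_one, Matrix.cons_val_zero,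
    Matrix.cons_val_one, S.γP_traceless]
  · ring
  · linear_combination 2 * hc - p * Φ I * ht
  · linear_combination -2 * hc + p * Φ I * ht
  · ring

end SpinFrame

end

section

/-! ### From the ring of smooth functions to spinor fields -/

variable {M : Type*} [TopologicalSpace M] [ChartedSpace (EuclideanSpace ℝ (Fin 4)) M]

/-- Evaluation of a smooth function at a point. -/
def evalAt (x : M) : smoothRing M →+* ℂ := (Pi.evalRingHom _ x).comp (smoothRing M).subtype

/-- `Φ` are the components of the spinor field `φ`. -/
def SpinorField.Represents {r : ℕ} (φ : SpinorField M r) (Φ : (Fin r → Fin 2) → smoothRing M) :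
    Prop :=
  ∀ x I, φ x I = evalAt x (Φ I)

theorem evalAt_ringEps (x : M) (A B : Fin 2) : evalAt x (ringEps (smoothRing M) A B) = eps A B := by
  fin_cases A <;> fin_cases B <;> simp [ringEps, eps]

variable [IsManifold (𝓡 4) ∞ M]

namespace SpinDyad

variable {g : LorentzMetric M} (d : SpinDyad g) {nab : AffineConnection M}

theorem evalAt_γ (hLC : IsLeviCivita g nab) (A A' B C : Fin 2) (x : M) :
    evalAt x ((d.frame hLC).γ A A' B C) = d.spinConn nab A A' B C x := rfl

theorem evalAt_idx (hLC : IsLeviCivita g nab) (s : IndexType) (A A' b c : Fin 2) (x : M) :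
    evalAt x ((d.frame hLC).idx s A A' b c) = d.indexConn nab s A A' x b c := by
  obtain ⟨p, u⟩ := s
  cases p <;> cases u <;> rfl

theorem covSpinor_eq (hLC : IsLeviCivita g nab) {r : ℕ} {φ : SpinorField M r}
    {Φ : (Fin r → Fin 2) → smoothRing M} (h : φ.Represents Φ) (k : Fin r → IndexType)
    (A A' : Fin 2) (x : M) (I : Fin r → Fin 2) :
    d.covSpinor nab k φ A A' x I = evalAt x ((d.frame hLC).cov k A A' Φ I) := by
  have hD : (d.tet A A').deriv (fun y ↦ φ y I) x = evalAt x ((d.frame hLC).D A A' (Φ I)) := by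
    rw [funext fun y ↦ h y I]
    rfl
  simp only [covSpinor, SpinFrame.cov, act_apply, map_add, map_sum, map_mul, d.evalAt_idx, hD,
    ← h x _]

theorem omega_tet (hLC : IsLeviCivita g nab) (A A' : Fin 2) (x : M) :
    d.omega nab (d.tet A A') x = -d.spinConn nab A A' 0 0 x := by
  have hl : d.l = d.tet 0 0 := rfl
  have hm : d.m = d.tet 0 1 := rfl
  have hb : d.mbar = d.tet 1 0 := rfl
  have hn : d.n = d.tet 1 1 := rfl
  simp only [omega, epsilon, epsilon', beta, beta', hl, hm, hb, hn,
    cval_symm _ (ccov nab _ _), d.cval_ccov_tet hLC, d.cval_tet]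
  fin_cases A <;> fin_cases A' <;> simp [eps, d.spinConn_traceless hLC,
    d.spinConnP_traceless hLC] <;> ring

theorem kappa_sigma_eq (hLC : IsLeviCivita g nab) (x : M) :
    d.kappa nab x = -d.spinConn nab 0 0 0 1 x ∧ d.sigma nab x = -d.spinConn nab 0 1 0 1 x := by
  have hl : d.l = d.tet 0 0 := rfl
  have hm : d.m = d.tet 0 1 := rfl
  simp only [kappa, sigma, hl, hm, cval_symm _ (ccov nab _ _), d.cval_ccov_tet hLC]
  simp [eps]

theorem f_tet (hLC : IsLeviCivita g nab) (A' : Fin 2) (x : M) :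
    d.f nab (d.tet 0 A') x = -d.spinConn nab 1 A' 0 1 x ∧
      d.f nab (d.tet 1 A') x = -d.spinConn nab 0 A' 1 0 x := by
  have hl : d.l = d.tet 0 0 := rfl
  have hm : d.m = d.tet 0 1 := rfl
  have hb : d.mbar = d.tet 1 0 := rfl
  have hn : d.n = d.tet 1 1 := rfl
  simp only [f, rho, rho', tau, tau', hl, hm, hb, hn,
    cval_symm _ (ccov nab _ _), d.cval_ccov_tet hLC, d.cval_tet]
  fin_cases A' <;> simp [eps]

theorem fTilde_represents (hLC : IsLeviCivita g nab) :
    (d.fTilde nab).Represents (d.frame hLC).fo := by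
  intro x J
  simp [fTilde, SpinFrame.fo, oUp, (d.f_tet hLC _ x).1, d.evalAt_γ]

theorem fIota_represents (hLC : IsLeviCivita g nab) :
    (d.fIota nab).Represents (d.frame hLC).fι := by
  intro x J
  simp [fIota, SpinFrame.fι, iotaUp, (d.f_tet hLC _ x).2, d.evalAt_γ]

theorem sigmaP_represents (hLC : IsLeviCivita g nab) :
    (d.sigmaP nab).Represents (d.frame hLC).sigι := by
  intro x J
  simp [sigmaP, SpinFrame.sigι, iotaUp, iotaLow, covSpinor, indexConn, low, eps, d.evalAt_γ,
    CVectorField.deriv_const]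

theorem theta_represents (hLC : IsLeviCivita g nab) {r : ℕ} {φ : SpinorField M r}
    {Φ : (Fin r → Fin 2) → smoothRing M} (h : φ.Represents Φ) (p : ℤ) (k : Fin r → IndexType) :
    (d.Theta nab p k φ).Represents ((d.frame hLC).thetaFull p k Φ) := by
  intro x J
  simp only [Theta, SpinFrame.thetaFull, SpinFrame.theta, d.covSpinor_eq hLC h, d.omega_tet hLC,
    h x _, map_sub, map_mul, map_intCast, d.evalAt_γ]
  ring

theorem thetaTilde_represents (hLC : IsLeviCivita g nab) {r : ℕ} {φ : SpinorField M r}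
    {Φ : (Fin r → Fin 2) → smoothRing M} (h : φ.Represents Φ) (p : ℤ) (k : Fin r → IndexType) :
    (d.ThetaTilde nab p k φ).Represents ((d.frame hLC).thetaProj p k 0 Φ) := by
  intro x J
  simp only [ThetaTilde, oUp, Fin.sum_univ_two, Matrix.cons_val_zero, Matrix.cons_val_one, one_mul,
    zero_mul, add_zero, d.theta_represents hLC h p k x _]
  rfl

theorem thetaIota_represents (hLC : IsLeviCivita g nab) {r : ℕ} {φ : SpinorField M r}
    {Φ : (Fin r → Fin 2) → smoothRing M} (h : φ.Represents Φ) (p : ℤ) (k : Fin r → IndexType) :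
    (d.ThetaIota nab p k φ).Represents ((d.frame hLC).thetaProj p k 1 Φ) := by
  intro x J
  simp only [ThetaIota, iotaUp, Fin.sum_univ_two, Matrix.cons_val_zero, Matrix.cons_val_one,
    one_mul, zero_mul, zero_add, d.theta_represents hLC h p k x _]
  rfl

theorem frame_typeII (hLC : IsLeviCivita g nab) {Λ : ℝ} (hE : d.IsEinstein nab Λ)
    (hII : d.IsTypeII nab) : (d.frame hLC).TypeII (constC M Λ) := by
  obtain ⟨h1, h2, h3⟩ := d.curv_relations hLC hE hII
  refine ⟨⟨fun C E ↦ (d.curvP_eq_zero hLC hE C E).1, fun C E ↦ (d.curvP_eq_zero hLC hE C E).2.1,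
    fun C E ↦ (d.curvP_eq_zero hLC hE C E).2.2⟩, fun A' ↦ ?_, h1, h2, h3⟩
  refine Subtype.ext (funext fun x ↦ ?_)
  obtain ⟨-, -, -, hκ, hσ⟩ := hII x
  rw [(d.kappa_sigma_eq hLC x).1, neg_eq_zero] at hκ
  rw [(d.kappa_sigma_eq hLC x).2, neg_eq_zero] at hσ
  fin_cases A'
  · exact hκ
  · exact hσ

end SpinDyad

theorem contract_eq (T : Fin 2 → Fin 2 → ℂ) : contract T = T 0 1 - T 1 0 := by
  simp [contract, eps]
  ring

end

end GHP

end

theorem typeII_projected_commutators {M : Type*} [TopologicalSpace M]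
    [ChartedSpace (EuclideanSpace ℝ (Fin 4)) M] [IsManifold (𝓡 4) ∞ M]
    (g : LorentzMetric M) (nab : AffineConnection M) (hLC : IsLeviCivita g nab)
    (d : SpinDyad g) (Λ : ℝ) (hE : d.IsEinstein nab Λ) (hII : d.IsTypeII nab)
    (p : ℤ) {r : ℕ} (k : Fin r → IndexType) (hk : ∀ j, (k j).primed = true)
    (φ : SpinorField M r) (hφ : φ.Smooth) (x : M) (I : Fin r → Fin 2) :
    -- (i)
    (∀ A' B' : Fin 2,
      d.ThetaTilde nab (p + 1) (Fin.cons lowP k) (d.ThetaTilde nab p k φ) x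
          (Fin.cons A' (Fin.cons B' I))
        - d.ThetaTilde nab (p + 1) (Fin.cons lowP k) (d.ThetaTilde nab p k φ) x
          (Fin.cons B' (Fin.cons A' I)) = 0) ∧
    -- (ii)
    (∀ A' B' : Fin 2,
      d.ThetaTilde nab (p - 1) (Fin.cons lowP k) (d.ThetaIota nab p k φ) x
          (Fin.cons A' (Fin.cons B' I))
        - d.ThetaIota nab (p + 1) (Fin.cons lowP k) (d.ThetaTilde nab p k φ) x
          (Fin.cons B' (Fin.cons A' I))
      = eps A' B' * ((p : ℂ) / 2)
            * (2 * contract (fun C D ↦ d.ThetaTilde nab (-1) ![lowP] (d.fIota nab) x ![C, D])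
              - contract (fun C D ↦ d.fTilde nab x ![C] * d.fIota nab x ![D])
              + 6 * (Λ : ℂ)) * φ x I
        + d.boxTheta nab p k φ x A' B' I
        - d.fIota nab x ![A'] * d.ThetaTilde nab p k φ x (Fin.cons B' I)
        + d.fTilde nab x ![B'] * d.ThetaIota nab p k φ x (Fin.cons A' I)) ∧
    -- (iii)
    (∀ A' B' : Fin 2,
      d.ThetaIota nab (p - 1) (Fin.cons lowP k) (d.ThetaIota nab p k φ) x
          (Fin.cons A' (Fin.cons B' I))
        - d.ThetaIota nab (p - 1) (Fin.cons lowP k) (d.ThetaIota nab p k φ) x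
          (Fin.cons B' (Fin.cons A' I))
      = eps A' B' * (((p : ℂ) / 2)
            * (contract (fun C D ↦ d.ThetaIota nab (-1) ![lowP] (d.fIota nab) x ![C, D])
              - contract (fun C D ↦ d.ThetaTilde nab (-3) ![lowP] (d.sigmaP nab) x ![C, D])
              + contract (fun C D ↦ d.fTilde nab x ![C] * d.sigmaP nab x ![D])) * φ x I
          - contract (fun C D ↦
              d.ThetaTilde nab p k φ x (Fin.cons C I) * d.sigmaP nab x ![D]))) ∧
    -- in particular, `Θ̃^{A'} Θ̃_{A'} φ = ε̄^{A'B'} Θ̃_{B'} Θ̃_{A'} φ = 0`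
    (∑ A' : Fin 2, ∑ B' : Fin 2,
      eps A' B' * d.ThetaTilde nab (p + 1) (Fin.cons lowP k) (d.ThetaTilde nab p k φ) x
        (Fin.cons B' (Fin.cons A' I)) = 0) := by
  have hR : φ.Represents (fun I ↦ ⟨fun y ↦ φ y I, hφ I⟩) := fun _ _ ↦ rfl
  generalize (fun I ↦ (⟨fun y ↦ φ y I, hφ I⟩ : smoothRing M)) = Φ at hR
  have h := d.frame_typeII hLC hE hII
  have hT := d.thetaTilde_represents hLC hR p k
  have hI := d.thetaIota_represents hLC hR p k
  have hf := d.fIota_represents hLC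
  have hΛ : evalAt x (SpinDyad.constC M Λ) = Λ := rfl
  have hi : ∀ A' B' : Fin 2,
      d.ThetaTilde nab (p + 1) (Fin.cons lowP k) (d.ThetaTilde nab p k φ) x
          (Fin.cons A' (Fin.cons B' I))
        - d.ThetaTilde nab (p + 1) (Fin.cons lowP k) (d.ThetaTilde nab p k φ) x
          (Fin.cons B' (Fin.cons A' I)) = 0 := by
    intro A' B'
    rw [d.thetaTilde_represents hLC hT, d.thetaTilde_represents hLC hT,
      h.tilde_tilde hk p Φ I A' B', sub_self]
  refine ⟨hi, fun A' B' ↦ ?_, fun A' B' ↦ ?_, ?_⟩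
  · have e := congrArg (evalAt x) (h.tilde_iota hk p Φ I A' B')
    simp only [map_mul, map_sub, map_add, map_neg, map_sum, map_ofNat, map_intCast,
      evalAt_ringEps, hΛ] at e
    simp only [SpinDyad.boxTheta, SpinDyad.Theta2, contract_eq,
      d.theta_represents hLC (d.theta_represents hLC hR p k) _ _ x _,
      d.thetaTilde_represents hLC hI _ _ x _, d.thetaIota_represents hLC hT _ _ x _,
      d.thetaTilde_represents hLC hf _ _ x _, hT x _, hI x _, hf x _,
      d.fTilde_represents hLC x _, hR x _]
    linear_combination (1 / 2) * e
  · have e := congrArg (evalAt x) (h.iota_iota hk p Φ I A' B')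
    simp only [map_mul, map_sub, map_add, map_ofNat, map_intCast, evalAt_ringEps] at e
    simp only [contract_eq, d.thetaIota_represents hLC hI _ _ x _,
      d.thetaIota_represents hLC hf _ _ x _,
      d.thetaTilde_represents hLC (d.sigmaP_represents hLC) _ _ x _, hT x _,
      d.sigmaP_represents hLC x _, d.fTilde_represents hLC x _, hR x _]
    linear_combination (1 / 2) * e
  · have e := hi 1 0
    simp only [Fin.sum_univ_two, eps, Matrix.of_apply, Matrix.cons_val_zero, Matrix.cons_val_one]
    linear_combination e
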